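/- arXiv:1609.08815 — 5 statements merged into one kernel-verified Lean document; each statement's English description precedes it below -/
import Mathlib

section
/- Let E be a normal subgroup of a finite group G and P a Sylow p-subgroup of E such that gcd(p−1, |G|) = 1. If P is cyclic, then E is p-nilpotent and E/O_{p'}(E) is contained in the hypercenter Z_∞(G/O_{p'}(E)). -/
open Subgroup Pointwise

variable {G : Type*}

/-- The conjugate subgroup `K ^ x = x⁻¹ K x`. -/
def sconj [Group G] (x : G) (K : Subgroup G) : Subgroup G :=
  K.map (MulAut.conj x⁻¹).toMonoidHom

/-- Two subgroups permute if `AB = BA` as subsets. -/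
def permutes [Group G] (A B : Subgroup G) : Prop :=
  (A : Set G) * (B : Set G) = (B : Set G) * (A : Set G)

/-- `H/K` is a chief factor of `G`. -/
def IsChiefFactor [Group G] (K H : Subgroup G) : Prop :=
  K.Normal ∧ H.Normal ∧ K < H ∧ ∀ N : Subgroup G, N.Normal → K < N → N ≤ H → N = H

/-- The factor `H/K` is cyclic (generated by a single coset). -/
def CyclicFactor [Group G] (K H : Subgroup G) : Prop :=
  ∃ g ∈ H, ∀ h ∈ H, ∃ n : ℤ, (g ^ n)⁻¹ * h ∈ K

/-- A group is `p`-soluble if every chief factor is a `p`-group or a `p'`-group. -/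
def pSoluble (p : ℕ) (X : Type*) [Group X] : Prop :=
  ∀ K H : Subgroup X, IsChiefFactor K H →
    (∃ n : ℕ, (K.subgroupOf H).index = p ^ n) ∨ ¬ p ∣ (K.subgroupOf H).index

/-- `p`-supersoluble: `p`-soluble and chief factors of order divisible by `p` have order `p`. -/
def pSupersoluble (p : ℕ) (X : Type*) [Group X] : Prop :=
  pSoluble p X ∧ ∀ K H : Subgroup X, IsChiefFactor K H →
    p ∣ (K.subgroupOf H).index → (K.subgroupOf H).index = p

/-- A Hall `s`-subgroup: its order involves only primes in `s`, its index none. -/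
def IsHallSigmaSubgroup {X : Type*} [Group X] (s : Set ℕ) (H : Subgroup X) : Prop :=
  (∀ q : ℕ, q.Prime → q ∣ Nat.card H → q ∈ s) ∧
    ∀ q : ℕ, q.Prime → q ∣ H.index → q ∉ s

/-- `σ` is a partition of the set of all primes. -/
def IsPrimePartition {ι : Type*} (σ : ι → Set ℕ) : Prop :=
  (∀ i, ∀ q ∈ σ i, Nat.Prime q) ∧ ∀ q : ℕ, q.Prime → ∃! i, q ∈ σ i

/-- `ℋ` (with labelling `j`) is a complete Hall `σ`-set. -/
def IsCompleteHallSigmaSet {X : Type*} [Group X] {ι : Type*} (σ : ι → Set ℕ)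
    {t : ℕ} (ℋ : Fin t → Subgroup X) (j : Fin t → ι) : Prop :=
  Function.Injective j ∧ (∀ i, IsHallSigmaSubgroup (σ (j i)) (ℋ i)) ∧
    ∀ a : ι, (∃ q : ℕ, q.Prime ∧ q ∈ σ a ∧ q ∣ Nat.card X) → ∃ i, j i = a

/-- `H` is σ-semipermutable with respect to `ℋ`. -/
def SigmaSemipermutable {X : Type*} [Group X] {t : ℕ} (H : Subgroup X)
    (ℋ : Fin t → Subgroup X) : Prop :=
  ∀ i : Fin t, Nat.Coprime (Nat.card H) (Nat.card (ℋ i)) →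
    ∀ x : X, permutes H (sconj x (ℋ i))

/-- `E/O ≤ Z_∞(G/O)`: there is an ascending chain from `O` which is central over `O`
and covers `E`. -/
def LeHypercenterOver [Group G] (O E : Subgroup G) : Prop :=
  ∃ n : ℕ, ∃ Z : ℕ → Subgroup G, Z 0 = O ∧ E ≤ Z n ∧
    ∀ i < n, Z i ≤ Z (i + 1) ∧ ∀ z ∈ Z (i + 1), ∀ g : G, z * g * z⁻¹ * g⁻¹ ∈ Z i

/-- `p`-nilpotent: has a normal `p`-complement. -/
def pNilpotent (p : ℕ) (X : Type*) [Group X] : Prop :=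
  ∃ N : Subgroup X, N.Normal ∧ ¬ p ∣ Nat.card N ∧
    ∀ q : ℕ, q.Prime → q ∣ N.index → q = p

/-- `O_{p'}(E)`, the largest normal `p'`-subgroup of `E`, as a subgroup of `G`. -/
def OpPrime (p : ℕ) [Group G] (E : Subgroup G) : Subgroup G :=
  ⨆ N ∈ {N : Subgroup G | N ≤ E ∧ (N.subgroupOf E).Normal ∧ ¬ p ∣ Nat.card N}, N

/-- `O_π(X)`, the largest normal `π`-subgroup. -/
def Oset (π : Set ℕ) (X : Type*) [Group X] : Subgroup X :=
  ⨆ N ∈ {N : Subgroup X | N.Normal ∧ ∀ q : ℕ, q.Prime → q ∣ Nat.card N → q ∈ π}, N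

/-- The Fitting subgroup: join of all normal nilpotent subgroups. -/
def FittingSub (X : Type*) [Group X] : Subgroup X :=
  ⨆ N ∈ {N : Subgroup X | N.Normal ∧ Group.IsNilpotent N}, N

/-- `G/C` is strictly `p`-closed (stated internally in `G`, over the subgroup `C`). -/
def StrictlyPClosedOver [Group G] (p : ℕ) (C : Subgroup G) : Prop :=
  ∃ S : Subgroup G, C ≤ S ∧ S.Normal ∧ (∀ s ∈ S, ∃ n : ℕ, s ^ p ^ n ∈ C) ∧
    ¬ p ∣ S.index ∧ (∀ a b : G, a * b * a⁻¹ * b⁻¹ ∈ S) ∧ ∀ a : G, a ^ (p - 1) ∈ S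


/-- A cyclic Sylow `p`-subgroup of a group of order prime to `p - 1` is central in its
normalizer. -/
theorem normalizer_le_centralizer_of_coprime_sub_one {X : Type*} [Group X] [Finite X] {p : ℕ}
    [hp : Fact p.Prime] (S : Sylow p X) (hS : IsCyclic S)
    (hco : Nat.Coprime (p - 1) (Nat.card X)) :
    normalizer (S : Set X) ≤ centralizer (S : Set X) := by
  have key := card_dvd_of_injective _ (QuotientGroup.kerLift_injective S.normalizerMonoidHom)
  rw [normalizerMonoidHom_ker, ← index, ← relIndex] at key
  refine relIndex_eq_one.mp (Nat.eq_one_of_dvd_coprimes ?_ dvd_rfl key)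
  obtain ⟨k, hk⟩ := S.2.exists_card_eq
  rcases Nat.eq_zero_or_pos k with h0 | h0
  · rw [hS.card_mulAut, hk, h0, pow_zero, Nat.totient_one]
    apply Nat.coprime_one_right
  rw [hS.card_mulAut, hk, Nat.totient_prime_pow Fact.out h0]
  refine (Nat.Coprime.pow_right _ ?_).mul_right ?_
  · apply Nat.Coprime.coprime_dvd_left (relIndex_dvd_of_le_left _ S.le_centralizer)
    apply Nat.Coprime.coprime_dvd_left (relIndex_dvd_index_of_le S.le_normalizer)
    rw [Nat.coprime_comm, Nat.Prime.coprime_iff_not_dvd Fact.out]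
    exact S.not_dvd_index
  · apply Nat.Coprime.coprime_dvd_left <| relIndex_dvd_card ..
    exact Nat.Coprime.coprime_dvd_left (card_subgroup_dvd_card _) hco.symm

/-- The elements of a normal subgroup of `p`-power index and order prime to `p` are exactly the
`p'`-elements. -/
theorem mem_iff_not_dvd_orderOf {X : Type*} [Group X] {p n : ℕ} (hp : p.Prime)
    (N : Subgroup X) [N.Normal] (hN : ¬ p ∣ Nat.card N) (hi : N.index = p ^ n) (x : X) :
    x ∈ N ↔ ¬ p ∣ orderOf x := by
  refine ⟨fun hx h => hN (h.trans (orderOf_dvd_natCard N hx)), fun hx => ?_⟩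
  have hc : Nat.Coprime (orderOf x) (p ^ n) :=
    ((hp.coprime_iff_not_dvd.mpr hx).pow_left n).symm
  rw [← QuotientGroup.eq_one_iff, ← orderOf_eq_one_iff]
  refine Nat.eq_one_of_dvd_coprimes hc (orderOf_map_dvd (QuotientGroup.mk' N) x) ?_
  rw [orderOf_dvd_iff_pow_eq_one, ← QuotientGroup.mk_pow, QuotientGroup.eq_one_iff, ← hi]
  exact N.pow_index_mem x

/-- A group whose order is prime to `p - 1` acts on a normal cyclic `p`-subgroup through powers
congruent to `1` modulo `p`. -/
theorem exists_conj_eq_zpow_of_coprime_sub_one {X : Type*} [Group X] [Finite X] {p n : ℕ}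
    (hp : p.Prime) (hco : Nat.Coprime (p - 1) (Nat.card X)) (c : X) (hc : c ^ p ^ n = 1)
    (hn : (zpowers c).Normal) (g : X) :
    ∃ m : ℤ, (p : ℤ) ∣ 1 - m ∧ g * c * g⁻¹ = c ^ m := by
  rcases eq_or_ne c 1 with rfl | hc1
  · exact ⟨1, by simp, by simp⟩
  obtain ⟨m, hm⟩ := mem_zpowers_iff.mp (hn.conj_mem c (mem_zpowers c) g)
  refine ⟨m, ?_, hm.symm⟩
  have : Fact p.Prime := ⟨hp⟩
  have hpo : p ∣ orderOf c := by
    obtain ⟨k, -, hk⟩ := (Nat.dvd_prime_pow hp).mp (orderOf_dvd_of_pow_eq_one hc)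
    rcases k with _ | k
    · exact absurd (orderOf_eq_one_iff.mp (by simpa using hk)) hc1
    · exact hk ▸ dvd_pow_self p k.succ_ne_zero
  have hpow : ∀ k : ℕ, g ^ k * c * (g ^ k)⁻¹ = c ^ (m ^ k) := by
    intro k
    induction k with
    | zero => simp
    | succ k ih =>
      calc g ^ (k + 1) * c * (g ^ (k + 1))⁻¹ = g * (g ^ k * c * (g ^ k)⁻¹) * g⁻¹ := by
            rw [pow_succ']; group
        _ = c ^ (m ^ (k + 1)) := by rw [ih, ← conj_zpow, ← hm, ← zpow_mul, pow_succ']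
  have hcard : (p : ℤ) ∣ m ^ Nat.card X - 1 := by
    have h := hpow (Nat.card X)
    rw [pow_card_eq_one'] at h
    refine (Int.natCast_dvd_natCast.mpr hpo).trans (orderOf_dvd_iff_zpow_eq_one.mpr ?_)
    rw [zpow_sub, ← h]
    simp
  have hX : ((m : ZMod p)) ^ Nat.card X = 1 := by
    rw [← sub_eq_zero]
    exact_mod_cast (ZMod.intCast_zmod_eq_zero_iff_dvd _ p).mpr hcard
  have h0 : (m : ZMod p) ≠ 0 := fun h0 => by
    simp [h0, zero_pow Nat.card_pos.ne'] at hX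
  have hm1 : (m : ZMod p) = 1 := orderOf_eq_one_iff.mp <| Nat.eq_one_of_dvd_coprimes hco
    (orderOf_dvd_of_pow_eq_one (ZMod.pow_card_sub_one_eq_one h0)) (orderOf_dvd_of_pow_eq_one hX)
  rw [← ZMod.intCast_zmod_eq_zero_iff_dvd]
  simp [hm1]

/-- A subgroup `E` whose image modulo a normal subgroup `O` is a cyclic `p`-group is hypercentral
modulo `O` when the order of the quotient is prime to `p - 1`. -/
theorem leHypercenterOver_of_map_eq_zpowers [Group G] [Finite G] {p n : ℕ} (hp : p.Prime)
    (E O : Subgroup G) [E.Normal] [O.Normal] (hco : Nat.Coprime (p - 1) (Nat.card (G ⧸ O)))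
    (c : G) (hc : (c : G ⧸ O) ^ p ^ n = 1)
    (hE : E.map (QuotientGroup.mk' O) = zpowers (c : G ⧸ O)) :
    LeHypercenterOver O E := by
  have hn : (zpowers (c : G ⧸ O)).Normal :=
    hE ▸ Normal.map inferInstance _ (QuotientGroup.mk'_surjective O)
  refine ⟨n, fun i => (zpowers ((c : G ⧸ O) ^ p ^ (n - i))).comap (QuotientGroup.mk' O),
    ?_, ?_, fun i hi => ⟨?_, ?_⟩⟩
  · simp [hc]
  · rw [← map_le_iff_le_comap, hE]
    simp
  · refine comap_mono ((zpowers_le).mpr ?_)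
    obtain ⟨k, hk⟩ : p ^ (n - (i + 1)) ∣ p ^ (n - i) := pow_dvd_pow p (by omega)
    rw [hk, pow_mul]
    exact npow_mem_zpowers _ _
  · intro z hz g
    obtain ⟨k, hk⟩ := mem_zpowers_iff.mp (mem_comap.mp hz)
    obtain ⟨m, ⟨d, hd⟩, hm⟩ := exists_conj_eq_zpow_of_coprime_sub_one hp hco _ hc hn (g : G ⧸ O)
    refine mem_comap.mpr (mem_zpowers_iff.mpr ⟨k * d, ?_⟩)
    have hz' : (z : G ⧸ O) = (c : G ⧸ O) ^ ((p : ℤ) ^ (n - (i + 1)) * k) := by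
      rw [zpow_mul]
      exact_mod_cast hk.symm
    have hexp : (p : ℤ) ^ (n - i) = p ^ (n - (i + 1)) * p := by
      rw [← pow_succ]; congr 1; omega
    calc ((c : G ⧸ O) ^ p ^ (n - i)) ^ (k * d)
        = (c : G ⧸ O) ^ ((p : ℤ) ^ (n - (i + 1)) * k * (1 - m)) := by
          rw [hd, ← zpow_natCast, ← zpow_mul]
          push_cast
          rw [hexp]
          congr 1
          ring
      _ = (z : G ⧸ O) * (g * z * (g : G ⧸ O)⁻¹)⁻¹ := by
          rw [hz', ← conj_zpow, hm, ← zpow_mul, ← zpow_neg, ← zpow_add]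
          congr 1
          ring
      _ = QuotientGroup.mk' O (z * g * z⁻¹ * g⁻¹) := by
          simp only [QuotientGroup.mk'_apply, QuotientGroup.mk_mul, QuotientGroup.mk_inv]
          group

/-- A normal `p`-complement of `E` is the largest normal `p'`-subgroup of `E`. -/
theorem opPrime_eq_map_subtype [Group G] {p n : ℕ} (hp : p.Prime) (E : Subgroup G)
    (N : Subgroup E) [hN : N.Normal] (hNp : ¬ p ∣ Nat.card N) (hi : N.index = p ^ n) :
    OpPrime p E = N.map E.subtype := by
  apply le_antisymm
  · refine iSup₂_le fun M hM x hx => ⟨⟨x, hM.1 hx⟩, ?_, rfl⟩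
    rw [SetLike.mem_coe, mem_iff_not_dvd_orderOf hp N hNp hi, orderOf_mk]
    exact fun h => hM.2.2 (h.trans (orderOf_dvd_natCard M hx))
  · refine le_iSup₂_of_le (N.map E.subtype) ⟨map_subtype_le N, ?_, ?_⟩ le_rfl
    · rwa [← comap_subtype, comap_map_eq_self_of_injective E.subtype_injective]
    · rwa [Nat.card_congr (N.equivMapOfInjective _ E.subtype_injective).symm.toEquiv]

/-- `E ⊴ G`, `P` a Sylow `p`-subgroup of `E`, `gcd(p-1,|G|) = 1` and `P`
cyclic imply `E` is `p`-nilpotent and `E/O_{p'}(E) ≤ Z_∞(G/O_{p'}(E))`. -/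
theorem stmt5 [Group G] [Finite G] (p : ℕ) (hp : p.Prime) (E P : Subgroup G)
    (hE : E.Normal) (hPE : P ≤ E) (hPp : IsPGroup p P)
    (hSyl : ¬ p ∣ (P.subgroupOf E).index)
    (hco : Nat.Coprime (p - 1) (Nat.card G))
    (hcyc : IsCyclic P) :
    pNilpotent p E ∧ LeHypercenterOver (OpPrime p E) E := by
  have : Fact p.Prime := ⟨hp⟩
  let S : Sylow p E :=
    (hPp.of_equiv (subgroupOfEquivOfLe hPE).symm).toSylow hSyl
  have hSP : (S : Subgroup E) = P.subgroupOf E := rfl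
  have hScyc : IsCyclic S :=
    isCyclic_of_surjective (subgroupOfEquivOfLe hPE).symm (subgroupOfEquivOfLe hPE).symm.surjective
  have hSE := normalizer_le_centralizer_of_coprime_sub_one S hScyc
    (hco.coprime_dvd_right (card_subgroup_dvd_card E))
  have hcompl := MonoidHom.ker_transferSylow_isComplement' S hSE
  have hNp := MonoidHom.not_dvd_card_ker_transferSylow S hSE
  set N := (MonoidHom.transferSylow S hSE).ker
  obtain ⟨n, hn⟩ := S.2.exists_card_eq
  have hi : N.index = p ^ n := hcompl.symm.index_eq_card.trans hn
  refine ⟨⟨N, inferInstance, hNp, fun q hq hqi =>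
    (Nat.prime_dvd_prime_iff_eq hq hp).mp (hq.dvd_of_dvd_pow (hi ▸ hqi))⟩, ?_⟩
  rw [opPrime_eq_map_subtype hp E N hNp hi]
  have hmem : ∀ x, x ∈ N.map E.subtype ↔ x ∈ E ∧ ¬ p ∣ orderOf x := by
    intro x
    constructor
    · rintro ⟨y, hy, rfl⟩
      exact ⟨y.2, by simpa using (mem_iff_not_dvd_orderOf hp N hNp hi y).mp hy⟩
    · rintro ⟨hx, hxp⟩
      exact ⟨⟨x, hx⟩, (mem_iff_not_dvd_orderOf hp N hNp hi _).mpr (by simpa using hxp), rfl⟩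
  have hO : (N.map E.subtype).Normal := by
    refine ⟨fun x hx g => ?_⟩
    rw [hmem] at hx ⊢
    refine ⟨hE.conj_mem x hx.1 g, ?_⟩
    have := orderOf_injective (MulAut.conj g).toMonoidHom (MulAut.conj g).injective x
    simp only [MulEquiv.coe_toMonoidHom, MulAut.conj_apply] at this
    exact this ▸ hx.2
  obtain ⟨c, hc⟩ := hcyc.exists_generator
  refine leHypercenterOver_of_map_eq_zpowers (n := n) hp E _
    (hco.coprime_dvd_right (card_quotient_dvd_card _)) (c : G) ?_ ?_
  · rw [← QuotientGroup.mk_pow, QuotientGroup.eq_one_iff]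
    exact ⟨⟨c, hPE c.2⟩ ^ p ^ n, hi ▸ N.pow_index_mem _, rfl⟩
  · apply le_antisymm
    · rintro _ ⟨e, he, rfl⟩
      obtain ⟨⟨⟨a, ha⟩, ⟨s, hs⟩⟩, has⟩ := hcompl.2 ⟨e, he⟩
      obtain ⟨k, hk⟩ := mem_zpowers_iff.mp (hc ⟨s, hs⟩)
      have hes : e = a * (c : G) ^ k := by
        have := congrArg Subtype.val hk
        simp only [coe_zpow] at this
        rw [this]
        exact (congrArg Subtype.val has).symm
      refine mem_zpowers_iff.mpr ⟨k, ?_⟩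
      have ha1 : ((a : G) : G ⧸ N.map E.subtype) = 1 :=
        (QuotientGroup.eq_one_iff _).mpr ⟨a, ha, rfl⟩
      rw [QuotientGroup.mk'_apply, hes, QuotientGroup.mk_mul, ha1, one_mul, QuotientGroup.mk_zpow]
    · exact zpowers_le.mpr ⟨c, hPE c.2, rfl⟩
end

section
/- If a finite group G is p-supersoluble and O_{p'}(G) = 1, then p is the largest prime dividing |G|, G is supersoluble, and F(G) = O_p(G) is a Sylow p-subgroup of G. -/
open Subgroup Pointwise

variable {G : Type*}

theorem le_Oset [Group G] {π : Set ℕ} {N : Subgroup G} (hN : N.Normal)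
    (hπ : ∀ q : ℕ, q.Prime → q ∣ Nat.card N → q ∈ π) : N ≤ Oset π G :=
  le_iSup₂_of_le (f := fun (N : Subgroup G)
    (_ : N ∈ {N : Subgroup G | N.Normal ∧ ∀ q : ℕ, q.Prime → q ∣ Nat.card N → q ∈ π}) => N)
    N ⟨hN, hπ⟩ le_rfl

theorem eq_bot_of_normal_of_not_dvd_card [Group G] [Finite G] {p : ℕ}
    (hO : Oset {q : ℕ | q.Prime ∧ q ≠ p} G = ⊥) {N : Subgroup G} (hN : N.Normal)
    (hpN : ¬ p ∣ Nat.card N) : N = ⊥ :=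
  le_bot_iff.mp (hO ▸ le_Oset hN fun _ hq hqN => ⟨hq, fun h => hpN (h ▸ hqN)⟩)

theorem isPGroup_of_forall_prime_dvd_card [Group G] [Finite G] {p : ℕ} (hp : p.Prime)
    (h : ∀ q : ℕ, q.Prime → q ∣ Nat.card G → q = p) : IsPGroup p G := by
  rw [isPGroup_iff_primeFactors_card_subset hp.ne_zero, hp.primeFactors]
  intro q hq
  simpa using h q (Nat.prime_of_mem_primeFactors hq) (Nat.dvd_of_mem_primeFactors hq)

theorem IsPGroup.eq_of_prime_dvd_card [Group G] [Finite G] {p q : ℕ} (hp : p.Prime)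
    (h : IsPGroup p G) (hq : q.Prime) (hqG : q ∣ Nat.card G) : q = p := by
  have := Fact.mk hp
  obtain ⟨n, hn⟩ := IsPGroup.iff_card.mp h
  exact (Nat.prime_dvd_prime_iff_eq hq hp).mp (hq.dvd_of_dvd_pow (hn ▸ hqG))

/-- The conjugation action on a factor of prime order, as a character. -/
theorem exists_character_of_relIndex_eq_prime [Group G] [Finite G] {p : ℕ} (hp : p.Prime)
    {K H : Subgroup G} [K.Normal] [H.Normal] (hKH : K.relIndex H = p) :
    ∃ φ : G →* (ZMod p)ˣ, ∀ g, φ g = 1 → ∀ h ∈ H, g * h * g⁻¹ * h⁻¹ ∈ K := by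
  have hcard : Nat.card (H.map (QuotientGroup.mk' K)) = p := by
    rw [← relIndex_ker, QuotientGroup.ker_mk', hKH]
  have : (H.map (QuotientGroup.mk' K)).Normal :=
    Subgroup.Normal.map inferInstance _ (QuotientGroup.mk'_surjective K)
  have := Fact.mk hp
  have : IsCyclic (H.map (QuotientGroup.mk' K)) := isCyclic_of_prime_card hcard
  have e := IsCyclic.mulAutMulEquiv (H.map (QuotientGroup.mk' K))
  rw [hcard] at e
  refine ⟨e.toMonoidHom.comp (MulAut.conjNormal.comp (QuotientGroup.mk' K)), fun g hg h hh => ?_⟩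
  have h1 : MulAut.conjNormal (QuotientGroup.mk' K g) =
      (1 : MulAut (H.map (QuotientGroup.mk' K))) := e.injective (by simpa using hg)
  have h2 := congrArg Subtype.val
    (DFunLike.congr_fun h1 ⟨QuotientGroup.mk' K h, mem_map_of_mem _ hh⟩)
  rw [MulAut.conjNormal_apply] at h2
  rw [← QuotientGroup.eq_one_iff]
  simpa [mul_inv_eq_one] using h2

/-- There is a normal subgroup centralizing all chief factors of order `p` whose quotient is
abelian of exponent dividing `p - 1`. -/
theorem exists_normal_centralizing_chiefFactors [Group G] [Finite G] {p : ℕ} (hp : p.Prime) :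
    ∃ C : Subgroup G, C.Normal ∧ (∀ a b : G, a * b * a⁻¹ * b⁻¹ ∈ C) ∧
      (∀ a : G, a ^ (p - 1) ∈ C) ∧
      ∀ K H : Subgroup G, IsChiefFactor K H → K.relIndex H = p →
        ∀ g ∈ C, ∀ h ∈ H, g * h * g⁻¹ * h⁻¹ ∈ K := by
  let ι := {x : Subgroup G × Subgroup G // IsChiefFactor x.1 x.2 ∧ x.1.relIndex x.2 = p}
  have hφ (i : ι) : ∃ φ : G →* (ZMod p)ˣ,
      ∀ g, φ g = 1 → ∀ h ∈ i.1.2, g * h * g⁻¹ * h⁻¹ ∈ i.1.1 := by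
    have := i.2.1.1
    have := i.2.1.2.1
    exact exists_character_of_relIndex_eq_prime hp i.2.2
  choose φ hφ using hφ
  have := Fact.mk hp
  refine ⟨(MonoidHom.pi φ).ker, inferInstance, fun a b => ?_, fun a => ?_, ?_⟩
  · rw [MonoidHom.mem_ker]
    ext i
    simp
  · rw [MonoidHom.mem_ker, map_pow]
    ext1 i
    exact ZMod.units_pow_card_sub_one_eq_one p _
  · intro K H hKH hidx g hg
    exact hφ ⟨(K, H), hKH, hidx⟩ g (congrFun (MonoidHom.mem_ker.mp hg) _)

/-- An element of order prime to `p` commuting with a `p`-element commutator `[x, q]`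
commutes with `x`. -/
theorem commutator_eq_one_of_coprime [Group G] {p k : ℕ} {x q : G}
    (hcomm : Commute (x * q * x⁻¹ * q⁻¹) q) (hz : (x * q * x⁻¹ * q⁻¹) ^ p ^ k = 1)
    (hq : (orderOf q).Coprime p) : x * q * x⁻¹ * q⁻¹ = 1 := by
  have h1 : (x * q * x⁻¹ * q⁻¹) ^ orderOf q = 1 := by
    have h2 : (x * q * x⁻¹) ^ orderOf q = 1 := by rw [conj_pow, pow_orderOf_eq_one]; simp
    have h3 : (x * q * x⁻¹ * q⁻¹ * q) ^ orderOf q = 1 := by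
      rw [inv_mul_cancel_right, h2]
    rwa [hcomm.mul_pow, pow_orderOf_eq_one, mul_one] at h3
  rw [← orderOf_eq_one_iff]
  exact Nat.eq_one_of_dvd_coprimes (hq.pow_right k) (orderOf_dvd_of_pow_eq_one h1)
    (orderOf_dvd_of_pow_eq_one hz)

/-- Between normal subgroups `S < T` there is a chief factor with top `T`. -/
theorem exists_isChiefFactor_top [Group G] [Finite G] {S T : Subgroup G} (hS : S.Normal)
    (hT : T.Normal) (hST : S < T) : ∃ K, S ≤ K ∧ IsChiefFactor K T := by
  obtain ⟨K, hSK, hK⟩ := (Set.toFinite {K : Subgroup G | K.Normal ∧ K < T}).exists_le_maximal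
    (show S ∈ {K : Subgroup G | K.Normal ∧ K < T} from ⟨hS, hST⟩)
  refine ⟨K, hSK, hK.prop.1, hT, hK.prop.2, fun N hN hKN hNT => ?_⟩
  by_contra hne
  exact hKN.not_ge (hK.2 ⟨hN, lt_of_le_of_ne hNT hne⟩ hKN.le)

/-- Between normal subgroups `S < T` there is a chief factor with bottom `S`. -/
theorem exists_isChiefFactor_bot [Group G] [Finite G] {S T : Subgroup G} (hS : S.Normal)
    (hT : T.Normal) (hST : S < T) : ∃ H, H ≤ T ∧ IsChiefFactor S H := by
  obtain ⟨H, hHT, hH⟩ := (Set.toFinite {H : Subgroup G | H.Normal ∧ S < H}).exists_le_minimal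
    (show T ∈ {H : Subgroup G | H.Normal ∧ S < H} from ⟨hT, hST⟩)
  refine ⟨H, hHT, hS, hH.prop.1, hH.prop.2, fun N hN hSN hNH => ?_⟩
  exact le_antisymm hNH (hH.2 ⟨hN, hSN⟩ hNH)

/-- A `p'`-element centralizing every `p`-chief factor centralizes every normal `p`-subgroup. -/
theorem commute_of_centralizes_chiefFactors [Group G] [Finite G] {p : ℕ} (hp : p.Prime) {q : G}
    (hq : (orderOf q).Coprime p)
    (hc : ∀ K H : Subgroup G, IsChiefFactor K H → p ∣ K.relIndex H →
      ∀ h ∈ H, q * h * q⁻¹ * h⁻¹ ∈ K)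
    (R : Subgroup G) (hR : R.Normal) (hRp : IsPGroup p R) : ∀ x ∈ R, Commute x q := by
  induction R using WellFoundedLT.induction with
  | ind R ih =>
    intro x hx
    rcases eq_or_ne R ⊥ with rfl | hne
    · rw [mem_bot.mp hx]
      exact Commute.one_left q
    obtain ⟨S, -, hS⟩ := exists_isChiefFactor_top inferInstance hR (bot_lt_iff_ne_bot.mpr hne)
    have hSR := hS.2.2.1
    have := Fact.mk hp
    have hdvd : p ∣ S.relIndex R := by
      obtain ⟨n, hn⟩ := hRp.index (S.subgroupOf R)
      have hn0 : n ≠ 0 := by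
        rintro rfl
        exact hSR.not_ge (relIndex_eq_one.mp hn)
      exact (dvd_pow_self p hn0).trans hn.symm.dvd
    have hz : x * q * x⁻¹ * q⁻¹ ∈ S := by
      simpa [mul_assoc] using S.inv_mem (hc S R hS hdvd x hx)
    have hcomm := ih S hSR hS.1 (hRp.to_le hSR.le) _ hz
    obtain ⟨k, hk⟩ := hRp.to_le hSR.le |>.exists_pow_pow_eq_one ⟨_, hz⟩
    have h1 := commutator_eq_one_of_coprime hcomm (congrArg Subtype.val hk) hq
    exact mul_inv_eq_iff_eq_mul.mp (mul_inv_eq_one.mp h1)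

/-- If a normal `p`-subgroup has `p'`-index in the normal subgroup `N` and is centralized by the
`p'`-elements of `N`, then the `p'`-elements of `N` form a normal subgroup. -/
theorem exists_normal_complement_of_commute [Group G] [Finite G] {p : ℕ} (hp : p.Prime)
    {P N : Subgroup G} (hP : P.Normal) (hN : N.Normal) (hPN : P ≤ N) (hPp : IsPGroup p P)
    (hidx : ¬ p ∣ P.relIndex N)
    (hcomm : ∀ q ∈ N, (orderOf q).Coprime p → ∀ x ∈ P, Commute x q) :
    ∃ Q : Subgroup G, Q.Normal ∧ ¬ p ∣ Nat.card Q ∧ N = P ⊔ Q := by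
  have := Fact.mk hp
  have hcop : Nat.Coprime (Nat.card (P.subgroupOf N)) (P.subgroupOf N).index := by
    obtain ⟨n, hn⟩ := IsPGroup.iff_card.mp hPp
    rw [Nat.card_congr (subgroupOfEquivOfLe hPN).toEquiv, hn]
    exact Nat.Coprime.pow_left n ((Nat.Prime.coprime_iff_not_dvd hp).mpr hidx)
  obtain ⟨Q, hQ⟩ := exists_right_complement'_of_coprime hcop
  have hQcard : Nat.card (Q.map N.subtype) = P.relIndex N := by
    rw [card_subtype]
    exact hQ.symm.index_eq_card.symm
  have hQord : ∀ b ∈ Q.map N.subtype, (orderOf b).Coprime p := fun b hb =>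
    (((Nat.Prime.coprime_iff_not_dvd hp).mpr hidx).symm).of_dvd_left
      (hQcard ▸ Subgroup.orderOf_dvd_natCard _ hb)
  have hQN : Q.map N.subtype ≤ N := map_subtype_le Q
  have hsup : N = P ⊔ Q.map N.subtype := by
    have h := congrArg (Subgroup.map N.subtype) hQ.sup_eq_top
    rw [Subgroup.map_sup, map_subgroupOf_eq_of_le hPN, ← MonoidHom.range_eq_map,
      range_subtype] at h
    exact h.symm
  have hdisj : ∀ a ∈ P, a ∈ Q.map N.subtype → a = 1 := by
    rintro a haP ⟨b, hb, rfl⟩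
    have := Subgroup.disjoint_def.mp hQ.disjoint (x := b) (mem_subgroupOf.mpr haP) hb
    simp [this]
  have hmem : ∀ x ∈ N, (orderOf x).Coprime p → x ∈ Q.map N.subtype := by
    intro x hx hxp
    rw [hsup] at hx
    obtain ⟨a, ha, b, hb, rfl⟩ := mem_sup_of_normal_left.mp hx
    have hab := hcomm b (hQN hb) (hQord b hb) a ha
    have h1 := pow_orderOf_eq_one (a * b)
    rw [hab.mul_pow] at h1
    have h2 : a ^ orderOf (a * b) = 1 := hdisj _ (P.pow_mem ha _) (by
      rw [mul_eq_one_iff_eq_inv.mp h1]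
      exact inv_mem (pow_mem hb _))
    obtain ⟨k, hk⟩ := hPp.exists_pow_pow_eq_one ⟨a, ha⟩
    have h3 : a = 1 := by
      rw [← orderOf_eq_one_iff]
      exact Nat.eq_one_of_dvd_coprimes (hxp.pow_right k) (orderOf_dvd_of_pow_eq_one h2)
        (orderOf_dvd_of_pow_eq_one (congrArg Subtype.val hk))
    rwa [h3, one_mul]
  refine ⟨Q.map N.subtype, ⟨fun b hb g => ?_⟩, hQcard ▸ hidx, hsup⟩
  refine hmem _ (hN.conj_mem b (hQN hb) g) ?_
  have : orderOf (g * b * g⁻¹) = orderOf b := by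
    simpa using orderOf_injective (MulAut.conj g).toMonoidHom (MulAut.conj g).injective b
  exact this ▸ hQord b hb

/-- In a `p`-supersoluble group with `O_{p'}(G) = 1`, a normal subgroup centralizing every
`p`-chief factor is a `p`-group. -/
theorem isPGroup_of_centralizes_chiefFactors [Group G] [Finite G] {p : ℕ} (hp : p.Prime)
    (hsup : pSupersoluble p G) (hO : Oset {q : ℕ | q.Prime ∧ q ≠ p} G = ⊥)
    {C : Subgroup G} (hC : C.Normal)
    (hc : ∀ K H : Subgroup G, IsChiefFactor K H → p ∣ K.relIndex H →
      ∀ g ∈ C, ∀ h ∈ H, g * h * g⁻¹ * h⁻¹ ∈ K) : IsPGroup p C := by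
  have := Fact.mk hp
  obtain ⟨P, -, hP⟩ := (Set.toFinite
    {R : Subgroup G | R.Normal ∧ R ≤ C ∧ IsPGroup p R}).exists_le_maximal
    (show ⊥ ∈ _ from ⟨inferInstance, bot_le, IsPGroup.of_bot⟩)
  obtain ⟨hPn, hPC, hPp⟩ := hP.prop
  rcases hPC.eq_or_lt with rfl | hlt
  · exact hPp
  obtain ⟨N, hNC, hN⟩ := exists_isChiefFactor_bot hPn hC hlt
  have hPN := hN.2.2.1
  by_cases hdvd : p ∣ P.relIndex N
  · obtain ⟨n, hn⟩ := IsPGroup.iff_card.mp hPp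
    have hcard : Nat.card N = p ^ (n + 1) := by
      rw [← relIndex_bot_left, ← relIndex_mul_relIndex ⊥ P N bot_le hPN.le, relIndex_bot_left, hn,
        show P.relIndex N = p from hsup.2 P N hN hdvd, pow_succ]
    exact absurd (hP.2 ⟨hN.2.1, hNC, IsPGroup.of_card hcard⟩ hPN.le) hPN.not_ge
  · obtain ⟨Q, hQ, hQp, hsupr⟩ := exists_normal_complement_of_commute hp hPn hN.2.1 hPN.le hPp
      hdvd fun q hqN hq => commute_of_centralizes_chiefFactors hp hq
        (fun K H hKH hd => hc K H hKH hd q (hNC hqN)) P hPn hPp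
    rw [eq_bot_of_normal_of_not_dvd_card hO hQ hQp, sup_bot_eq] at hsupr
    exact absurd hsupr hPN.ne'

/-- If `O_{p'}(G) = 1` then normal nilpotent subgroups are `p`-groups. -/
theorem isPGroup_of_normal_of_isNilpotent [Group G] [Finite G] {p : ℕ} (hp : p.Prime)
    (hO : Oset {q : ℕ | q.Prime ∧ q ≠ p} G = ⊥) {N : Subgroup G} (hN : N.Normal)
    (hnil : Group.IsNilpotent N) : IsPGroup p N := by
  refine isPGroup_of_forall_prime_dvd_card hp fun q hq hqN => ?_
  by_contra hne
  have := Fact.mk hq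
  let Q : Sylow q N := default
  have : (Q : Subgroup N).Characteristic := Q.characteristic_of_normal inferInstance
  have hQ : (Q : Subgroup N).map N.subtype = ⊥ := by
    refine eq_bot_of_normal_of_not_dvd_card hO inferInstance fun hpQ => hne ?_
    rw [card_subtype] at hpQ
    exact (IsPGroup.eq_of_prime_dvd_card hq Q.isPGroup' hp hpQ).symm
  rw [map_eq_bot_iff_of_injective _ N.subtype_injective] at hQ
  have := Q.dvd_card_of_dvd_card hqN
  rw [hQ, card_bot] at this
  exact hq.one_lt.ne' (Nat.dvd_one.mp this)

/-- A chief factor that is central is cyclic. -/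
theorem cyclicFactor_of_central [Group G] {K H : Subgroup G} (hKH : IsChiefFactor K H)
    (hc : ∀ g : G, ∀ h ∈ H, g * h * g⁻¹ * h⁻¹ ∈ K) : CyclicFactor K H := by
  obtain ⟨hK, -, hlt, hmin⟩ := hKH
  obtain ⟨x, hxH, hxK⟩ := SetLike.exists_of_lt hlt
  have hle : K ⊔ zpowers x ≤ H := sup_le hlt.le (zpowers_le.mpr hxH)
  have hnorm : (K ⊔ zpowers x).Normal := by
    refine ⟨fun y hy g => ?_⟩
    have := mul_mem ((le_sup_left : K ≤ K ⊔ zpowers x) (hc g y (hle hy))) hy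
    rwa [inv_mul_cancel_right] at this
  have heq := hmin _ hnorm (lt_of_le_of_ne le_sup_left fun h =>
    hxK (h ▸ (le_sup_right : zpowers x ≤ K ⊔ zpowers x) (mem_zpowers x))) hle
  refine ⟨x, hxH, fun h hh => ?_⟩
  rw [← heq, sup_comm] at hh
  obtain ⟨y, hy, k, hk, rfl⟩ := mem_sup_of_normal_right.mp hh
  obtain ⟨n, rfl⟩ := mem_zpowers_iff.mp hy
  exact ⟨n, by rwa [inv_mul_cancel_left]⟩

/-- If the quotient by a normal `p`-subgroup is abelian, then the chief factors that are not of
order divisible by `p` are central. -/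
theorem central_of_not_dvd_relIndex [Group G] [Finite G] {p : ℕ} {C : Subgroup G}
    (hCp : IsPGroup p C) (hcomm : ∀ a b : G, a * b * a⁻¹ * b⁻¹ ∈ C) (hp : p.Prime)
    {K H : Subgroup G} (hK : K.Normal) (hH : H.Normal) (hidx : ¬ p ∣ K.relIndex H)
    (g h : G) (hh : h ∈ H) : g * h * g⁻¹ * h⁻¹ ∈ K := by
  have hzH : g * h * g⁻¹ * h⁻¹ ∈ H := mul_mem (hH.conj_mem h hh g) (inv_mem hh)
  obtain ⟨k, hk⟩ := hCp.exists_pow_pow_eq_one ⟨_, hcomm g h⟩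
  have hk' : (g * h * g⁻¹ * h⁻¹) ^ p ^ k = 1 := congrArg Subtype.val hk
  have h1 : (⟨_, hzH⟩ : H) ^ K.relIndex H ∈ K.subgroupOf H := pow_index_mem _ _
  rw [← QuotientGroup.eq_one_iff, QuotientGroup.mk_pow] at h1
  have h2 : ((⟨_, hzH⟩ : H) : H ⧸ K.subgroupOf H) ^ p ^ k = 1 := by
    rw [← QuotientGroup.mk_pow, show (⟨_, hzH⟩ : H) ^ p ^ k = 1 from Subtype.ext hk',
      QuotientGroup.mk_one]
  have h3 := orderOf_eq_one_iff.mp (Nat.eq_one_of_dvd_coprimes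
    (((Nat.Prime.coprime_iff_not_dvd hp).mpr hidx).symm.pow_right k)
    (orderOf_dvd_of_pow_eq_one h1) (orderOf_dvd_of_pow_eq_one h2))
  exact mem_subgroupOf.mp ((QuotientGroup.eq_one_iff _).mp h3)

/-- A subgroup that is a `p`-group is contained in every normal subgroup whose quotient has
exponent prime to `p`. -/
theorem IsPGroup.le_of_pow_mem [Group G] {p m : ℕ} {P C : Subgroup G} [C.Normal]
    (hP : IsPGroup p P) (hm : m.Coprime p) (hpow : ∀ a : G, a ^ m ∈ C) : P ≤ C := by
  intro x hx
  obtain ⟨k, hk⟩ := hP.exists_pow_pow_eq_one ⟨x, hx⟩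
  have hk' : x ^ p ^ k = 1 := congrArg Subtype.val hk
  rw [← QuotientGroup.eq_one_iff, ← orderOf_eq_one_iff]
  refine Nat.eq_one_of_dvd_coprimes (hm.pow_right k) (orderOf_dvd_of_pow_eq_one ?_)
    (orderOf_dvd_of_pow_eq_one ?_)
  · rw [← QuotientGroup.mk_pow, QuotientGroup.eq_one_iff]
    exact hpow x
  · rw [← QuotientGroup.mk_pow, hk', QuotientGroup.mk_one]

/-- A prime dividing the index of a normal subgroup divides every exponent of the quotient. -/
theorem prime_dvd_of_dvd_index_of_pow_mem [Group G] [Finite G] {q m : ℕ} {C : Subgroup G}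
    [C.Normal] (hq : q.Prime) (hqC : q ∣ C.index) (hpow : ∀ a : G, a ^ m ∈ C) : q ∣ m := by
  have := Fact.mk hq
  obtain ⟨x, hx⟩ := exists_prime_orderOf_dvd_card' (G := G ⧸ C) q hqC
  obtain ⟨a, rfl⟩ := QuotientGroup.mk_surjective x
  rw [← hx]
  apply orderOf_dvd_of_pow_eq_one
  rw [← QuotientGroup.mk_pow, QuotientGroup.eq_one_iff]
  exact hpow a

/-- If `G` is `p`-supersoluble and `O_{p'}(G) = 1`, then `p` is the
largest prime dividing `|G|`, `G` is supersoluble, and `F(G) = O_p(G)` is a Sylow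
`p`-subgroup of `G`. -/
theorem stmt7 [Group G] [Finite G] (p : ℕ) (hp : p.Prime)
    (hsup : pSupersoluble p G)
    (hO : Oset {q : ℕ | q.Prime ∧ q ≠ p} G = ⊥) :
    (∀ q : ℕ, q.Prime → q ∣ Nat.card G → q ≤ p) ∧
    (∀ K H : Subgroup G, IsChiefFactor K H → CyclicFactor K H) ∧
    FittingSub G = Oset {p} G ∧
    IsPGroup p (Oset {p} G) ∧ ¬ p ∣ (Oset {p} G).index := by
  have := Fact.mk hp
  obtain ⟨C, hC, hcomm, hpow, hcent⟩ := exists_normal_centralizing_chiefFactors (G := G) hp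
  have hCp : IsPGroup p C := isPGroup_of_centralizes_chiefFactors hp hsup hO hC
    fun K H hKH hd => hcent K H hKH (hsup.2 K H hKH hd)
  have hlt : ∀ q : ℕ, q.Prime → q ∣ C.index → q < p := fun q hq hqC => by
    have := Nat.le_of_dvd (Nat.sub_pos_of_lt hp.one_lt)
      (prime_dvd_of_dvd_index_of_pow_mem hq hqC hpow)
    have := hp.pos
    omega
  have hle : ∀ P : Subgroup G, IsPGroup p P → P ≤ C := fun P hP =>
    hP.le_of_pow_mem ((Nat.coprime_self_sub_left hp.one_le).mpr (Nat.coprime_one_left p)) hpow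
  have hOC : Oset {p} G = C := by
    refine le_antisymm (iSup₂_le fun N hN => hle N ?_)
      (le_Oset hC fun q hq hqC => hCp.eq_of_prime_dvd_card hp hq hqC)
    exact isPGroup_of_forall_prime_dvd_card hp hN.2
  have hFC : FittingSub G = C := by
    refine le_antisymm (iSup₂_le fun N hN =>
      hle N (isPGroup_of_normal_of_isNilpotent hp hO hN.1 hN.2)) ?_
    exact le_iSup₂_of_le (f := fun (N : Subgroup G)
      (_ : N ∈ {N : Subgroup G | N.Normal ∧ Group.IsNilpotent N}) => N)
      C ⟨hC, hCp.isNilpotent⟩ le_rfl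
  rw [hFC, hOC]
  refine ⟨fun q hq hqG => ?_, fun K H hKH => ?_, rfl, hCp, fun h => (hlt p hp h).false⟩
  · rw [← C.card_mul_index] at hqG
    rcases hq.dvd_mul.mp hqG with h | h
    · exact (hCp.eq_of_prime_dvd_card hp hq h).le
    · exact (hlt q hq h).le
  · by_cases hd : p ∣ K.relIndex H
    · have hidx : K.relIndex H = p := hsup.2 K H hKH hd
      have := hKH.1
      have : IsCyclic (H ⧸ K.subgroupOf H) := isCyclic_of_prime_card hidx
      obtain ⟨x, hx⟩ := IsCyclic.exists_generator (α := H ⧸ K.subgroupOf H)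
      obtain ⟨g, rfl⟩ := QuotientGroup.mk_surjective x
      refine ⟨g, g.2, fun h hh => ?_⟩
      obtain ⟨n, hn⟩ := mem_zpowers_iff.mp (hx ((⟨h, hh⟩ : H) : H ⧸ K.subgroupOf H))
      rw [← QuotientGroup.mk_zpow, QuotientGroup.eq] at hn
      exact ⟨n, mem_subgroupOf.mp hn⟩
    · exact cyclicFactor_of_central hKH
        (central_of_not_dvd_relIndex hCp hcomm hp hKH.1 hKH.2.1 hd)
end

section
/- (Gaschütz–Itô) If every minimal subgroup (subgroup of prime order) of a finite group G is normal in G, then G is soluble, and the derived subgroup G' has a normal Sylow 2-subgroup with nilpotent factor group. -/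
open Subgroup Pointwise

variable {G : Type*}

/-- If `b * a = a * b * k` with `k` central, then `b ^ n * a = a * b ^ n * k ^ n`. -/
theorem pow_mul_eq_of_central_commutator [Group G] {a b k : G} (hk : ∀ g, k * g = g * k)
    (hab : b * a = a * b * k) (n : ℕ) : b ^ n * a = a * b ^ n * k ^ n := by
  have hkn : ∀ (n : ℕ) g, k ^ n * g = g * k ^ n := fun n g => (Commute.pow_left (hk g) n)
  induction n with
  | zero => simp
  | succ n ih =>
    calc b ^ (n + 1) * a = b ^ n * (b * a) := by rw [pow_succ, mul_assoc]
      _ = (b ^ n * a) * b * k := by rw [hab]; group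
      _ = a * b ^ n * (k ^ n * b) * k := by rw [ih]; group
      _ = a * b ^ (n + 1) * k ^ (n + 1) := by rw [hkn, pow_succ b, pow_succ k]; group

/-- The power formula in a group where the commutator of the two factors is central. -/
theorem mul_pow_of_central_commutator [Group G] {a b k : G} (hk : ∀ g, k * g = g * k)
    (hab : b * a = a * b * k) (n : ℕ) : (a * b) ^ n = a ^ n * b ^ n * k ^ n.choose 2 := by
  have hkn : ∀ (n : ℕ) g, k ^ n * g = g * k ^ n := fun n g => (Commute.pow_left (hk g) n)
  induction n with
  | zero => simp
  | succ n ih =>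
    have hc : (n + 1).choose 2 = n + n.choose 2 := by
      rw [Nat.choose_succ_succ' n 1, Nat.choose_one_right]
    calc (a * b) ^ (n + 1) = a ^ n * b ^ n * (k ^ n.choose 2 * (a * b)) := by
          rw [pow_succ, ih]; group
      _ = a ^ n * (b ^ n * a) * b * k ^ n.choose 2 := by rw [hkn]; group
      _ = a ^ n * a * b ^ n * (k ^ n * b) * k ^ n.choose 2 := by
          rw [pow_mul_eq_of_central_commutator hk hab]; group
      _ = a ^ (n + 1) * b ^ (n + 1) * k ^ (n + 1).choose 2 := by
          rw [hkn, hc, pow_add, pow_succ a, pow_succ b]; group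

/-- If `f` has finite order prime to `p` on a `p`-group and `q⁻¹ * f q` is fixed by `f`,
then `q` is fixed by `f`. -/
theorem IsPGroup.fixed_of_fixed_inv_mul {p n : ℕ} {Q : Type*} [Group Q] (hQ : IsPGroup p Q)
    (hn : p.Coprime n) (f : Q →* Q) (hf : ∀ q, f^[n] q = q) {q : Q}
    (hu : f (q⁻¹ * f q) = q⁻¹ * f q) : f q = q := by
  set u := q⁻¹ * f q with hudef
  have hq : f q = q * u := by simp [hudef]
  have hit : ∀ k : ℕ, f^[k] q = q * u ^ k := by
    intro k
    induction k with
    | zero => simp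
    | succ k ih => rw [Function.iterate_succ_apply', ih, map_mul, map_pow, hu, hq, mul_assoc,
        pow_succ']
  have hun : u ^ n = 1 := by simpa [hf q] using (hit n).symm
  have h1 : orderOf u = 1 :=
    Nat.eq_one_of_dvd_coprimes (hQ.orderOf_coprime hn u) dvd_rfl (orderOf_dvd_of_pow_eq_one hun)
  rw [hq, orderOf_eq_one_iff.mp h1, mul_one]

/-- The subgroup generated by commutators and `p`-th powers. -/
def commutatorPow (p : ℕ) (Q : Type*) [Group Q] : Subgroup Q :=
  (powMonoidHom p : Abelianization Q →* Abelianization Q).range.comap Abelianization.of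

theorem mem_commutatorPow {p : ℕ} {Q : Type*} [Group Q] {q : Q} :
    q ∈ commutatorPow p Q ↔ ∃ b : Q, Abelianization.of b ^ p = Abelianization.of q := by
  constructor
  · rintro ⟨a, ha⟩
    obtain ⟨b, rfl⟩ := QuotientGroup.mk_surjective a
    exact ⟨b, ha⟩
  · rintro ⟨b, hb⟩
    exact ⟨_, hb⟩

theorem commutatorPow_ne_top {p : ℕ} [Fact p.Prime] {Q : Type*} [Group Q] [Finite Q] [Nontrivial Q]
    (hQ : IsPGroup p Q) : commutatorPow p Q ≠ ⊤ := by
  intro htop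
  have hof : Function.Surjective (Abelianization.of : Q →* Abelianization Q) :=
    QuotientGroup.mk_surjective
  have : Finite (Abelianization Q) := Finite.of_surjective _ hof
  have hsurj : Function.Surjective (fun a : Abelianization Q => a ^ p) := by
    intro a
    obtain ⟨q, rfl⟩ := hof a
    obtain ⟨b, hb⟩ := mem_commutatorPow.mp (htop ▸ Subgroup.mem_top q : q ∈ commutatorPow p Q)
    exact ⟨_, hb⟩
  have hinj := Finite.injective_iff_surjective.mpr hsurj
  have hnil : Group.IsNilpotent Q := hQ.isNilpotent
  have hlt : commutator Q < ⊤ := Group.IsSolvable.commutator_lt_top_of_nontrivial Q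
  refine hlt.ne (top_le_iff.mp fun q _ => ?_)
  obtain ⟨k, hk⟩ := hQ q
  have h1 : (fun a : Abelianization Q => a ^ p)^[k] (Abelianization.of q) =
      (fun a : Abelianization Q => a ^ p)^[k] 1 := by
    rw [pow_iterate]
    simp only [one_pow, ← map_pow, hk, map_one]
  rw [← Abelianization.ker_of, MonoidHom.mem_ker]
  exact hinj.iterate k h1

/-- For odd `p`, an endomorphism of finite order prime to `p` of a finite `p`-group which fixes
every element of order `p` is trivial. -/
theorem IsPGroup.fixed_of_fixed_pow_eq_one {p n : ℕ} [Fact p.Prime] (hp2 : p ≠ 2)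
    (hn : p.Coprime n) {Q : Type*} [Group Q] [Finite Q] (hQ : IsPGroup p Q) (f : Q →* Q)
    (hf : ∀ q, f^[n] q = q) (hfix : ∀ z, z ^ p = 1 → f z = z) (q : Q) : f q = q := by
  induction hm : Nat.card Q using Nat.strong_induction_on generalizing Q with
  | _ m ih =>
  subst hm
  rcases subsingleton_or_nontrivial Q with hs | hs
  · exact Subsingleton.elim _ _
  have hsub : ∀ H : Subgroup Q, H ≠ ⊤ → (∀ h ∈ H, f h ∈ H) → ∀ h ∈ H, f h = h := by
    intro H hH hinv h hh
    let g : H →* H := (f.comp H.subtype).codRestrict H fun x => hinv x x.2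
    have hg : Function.Semiconj (Subtype.val : H → Q) g f := fun x => rfl
    have := ih (Nat.card H) (lt_of_le_of_ne (Subgroup.card_le_card_group H)
      fun h => hH (Subgroup.eq_top_of_card_eq H h)) (hQ.to_subgroup H) g
      (fun x => Subtype.ext (by rw [hg.iterate_right n x, hf]))
      (fun z hz => Subtype.ext (hfix z (by rw [← Subgroup.coe_pow, hz, Subgroup.coe_one])))
      ⟨h, hh⟩ rfl
    exact congrArg Subtype.val this
  have hΦ := hsub (commutatorPow p Q) (commutatorPow_ne_top hQ) fun h hh => by
    obtain ⟨b, hb⟩ := mem_commutatorPow.mp hh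
    refine mem_commutatorPow.mpr ⟨f b, ?_⟩
    rw [← Abelianization.map_of, ← Abelianization.map_of, ← map_pow, hb]
  have hcent : ∀ g, g⁻¹ * f g ∈ centralizer (commutatorPow p Q : Set Q) := by
    intro g
    rw [mem_centralizer_iff]
    intro z hz
    have hnorm : (commutatorPow p Q).Normal := by
      unfold commutatorPow; infer_instance
    have h1 := hΦ _ (hnorm.conj_mem z hz g)
    rw [map_mul, map_mul, map_inv, hΦ z hz, mul_inv_eq_iff_eq_mul] at h1
    rw [mul_assoc, h1]
    group
  by_cases hC : centralizer (commutatorPow p Q : Set Q) = ⊤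
  swap
  · refine hQ.fixed_of_fixed_inv_mul hn f hf (hsub _ hC (fun c hc => ?_) _ (hcent q))
    rw [mem_centralizer_iff] at hc ⊢
    intro z hz
    rw [← hΦ z hz, ← map_mul, ← map_mul, hc z hz]
  have hcen : ∀ z ∈ commutatorPow p Q, ∀ g, z * g = g * z := fun z hz g =>
    mem_centralizer_iff.mp (hC ▸ mem_top g) z hz
  have hpow : ∀ g : Q, g ^ p ∈ commutatorPow p Q := fun g =>
    mem_commutatorPow.mpr ⟨g, (map_pow _ _ _).symm⟩
  obtain ⟨k, hkdef⟩ : ∃ k, k = (q⁻¹ * f q)⁻¹ * (f q * q⁻¹) := ⟨_, rfl⟩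
  have hab : f q * q⁻¹ = q⁻¹ * f q * k := by rw [hkdef]; group
  have hk : ∀ g, k * g = g * k := hcen k <| mem_commutatorPow.mpr ⟨1, by
    rw [hkdef]; simp [mul_comm]⟩
  have hkp : k ^ p = 1 := by
    have h1 := pow_mul_eq_of_central_commutator hk hab p
    rw [hcen _ (hpow (f q))] at h1
    simpa using h1
  have hfq : f q ^ p = q ^ p := by rw [← map_pow, hΦ _ (hpow q)]
  refine hQ.fixed_of_fixed_inv_mul hn f hf (hfix _ ?_)
  have hlt : 2 < p := lt_of_le_of_ne (Fact.out : p.Prime).two_le (Ne.symm hp2)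
  obtain ⟨d, hd⟩ := (Fact.out : p.Prime).dvd_choose_self two_ne_zero hlt
  rw [mul_pow_of_central_commutator hk hab, hfq, hd, pow_mul, hkp]
  simp

/-- If `p` is odd and the elements of order `p` are central, then every `p'`-element normalizing a
`p`-subgroup centralizes it. -/
theorem mem_centralizer_of_mem_normalizer_of_coprime [Group G] [Finite G] {p : ℕ} [Fact p.Prime]
    (hp2 : p ≠ 2) (hz : ∀ z : G, z ^ p = 1 → ∀ g, g * z = z * g) (Q : Subgroup G)
    (hQ : IsPGroup p Q) (y : G) (hy : y ∈ normalizer (Q : Set G)) (hyp : (orderOf y).Coprime p) :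
    y ∈ centralizer (Q : Set G) := by
  let f : Q →* Q := (Q.normalizerMonoidHom ⟨y, hy⟩).toMonoidHom
  have hf1 : ∀ q : Q, (f q : G) = y * q * y⁻¹ := fun q => rfl
  have hfk : ∀ (k : ℕ) (q : Q), ((f^[k] q : Q) : G) = y ^ k * q * (y ^ k)⁻¹ := by
    intro k q
    induction k with
    | zero => simp
    | succ k ih => rw [Function.iterate_succ_apply', hf1, ih, pow_succ']; group
  rw [mem_centralizer_iff]
  intro q hq
  have := hQ.fixed_of_fixed_pow_eq_one hp2 hyp.symm f
    (fun q => Subtype.ext (by rw [hfk, pow_orderOf_eq_one]; simp))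
    (fun z hzp => Subtype.ext (by
      rw [hf1, hz z (by rw [← Subgroup.coe_pow, hzp, Subgroup.coe_one])]; simp)) ⟨q, hq⟩
  have h2 := congrArg Subtype.val this
  rw [hf1, mul_inv_eq_iff_eq_mul] at h2
  exact h2.symm

theorem isPGroup_quotient_of_coprime_mem [Group G] [Finite G] {p : ℕ} [Fact p.Prime]
    (C : Subgroup G) [C.Normal] (hC : ∀ y, (orderOf y).Coprime p → y ∈ C) : IsPGroup p (G ⧸ C) := by
  intro g
  obtain ⟨g, rfl⟩ := QuotientGroup.mk_surjective g
  obtain ⟨a, m, hm, ha⟩ := Nat.exists_eq_pow_mul_and_not_dvd (orderOf_pos g).ne' p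
    (Fact.out : p.Prime).ne_one
  refine ⟨a, ?_⟩
  rw [← QuotientGroup.mk_pow, QuotientGroup.eq_one_iff]
  apply hC
  rw [orderOf_pow_of_dvd (pow_ne_zero _ (Fact.out : p.Prime).ne_zero) (ha ▸ dvd_mul_right _ _), ha,
    Nat.mul_div_cancel_left _ (pow_pos (Fact.out : p.Prime).pos _)]
  exact ((Fact.out : p.Prime).coprime_iff_not_dvd.mpr hm).symm

theorem Sylow.sup_eq_top_of_isPGroup_quotient [Group G] [Finite G] {p : ℕ} [Fact p.Prime]
    (C : Subgroup G) [C.Normal] (hC : IsPGroup p (G ⧸ C)) (P : Sylow p G) :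
    C ⊔ (P : Subgroup G) = ⊤ := by
  obtain ⟨k, hk⟩ := IsPGroup.iff_card.mp hC
  have h1 : (C ⊔ (P : Subgroup G)).index ∣ p ^ k := by
    rw [← hk]; exact index_dvd_of_le le_sup_left
  have h2 : (C ⊔ (P : Subgroup G)).index ∣ (P : Subgroup G).index := index_dvd_of_le le_sup_right
  refine index_eq_one.mp (Nat.eq_one_of_dvd_coprimes ?_ h1 h2)
  exact Nat.Coprime.pow_left k ((Fact.out : p.Prime).coprime_iff_not_dvd.mpr P.not_dvd_index)

/-- If `p'`-elements normalizing the `p`-subgroup `Q` centralize it, then `N(Q) = C(Q) S` for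
every Sylow `p`-subgroup `S` of `N(Q)`. -/
theorem exists_eq_centralizer_mul_sylow [Group G] [Finite G] {p : ℕ} [Fact p.Prime]
    {Q : Subgroup G}
    (hF : ∀ y ∈ normalizer (Q : Set G), (orderOf y).Coprime p → y ∈ centralizer (Q : Set G))
    (S : Sylow p (normalizer (Q : Set G))) (n : normalizer (Q : Set G)) :
    ∃ c : normalizer (Q : Set G), (c : G) ∈ centralizer (Q : Set G) ∧ ∃ s ∈ S, n = c * s := by
  let C := (centralizer (Q : Set G)).subgroupOf (normalizer (Q : Set G))
  have hCn : C.Normal := by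
    change ((centralizer (Q : Set G)).subgroupOf (normalizer (Q : Set G))).Normal
    rw [← normalizerMonoidHom_ker]; infer_instance
  have hp : IsPGroup p (normalizer (Q : Set G) ⧸ C) :=
    isPGroup_quotient_of_coprime_mem C fun y hy => hF y y.2 (by rwa [Subgroup.orderOf_coe])
  have hn : n ∈ C ⊔ (S : Subgroup _) := by
    rw [Sylow.sup_eq_top_of_isPGroup_quotient C hp S]; trivial
  rw [mem_sup_of_normal_left] at hn
  obtain ⟨c, hc, s, hs, h⟩ := hn
  exact ⟨c, hc, s, hs, h.symm⟩

theorem IsPGroup.exists_mem_normalizer_notMem [Group G] [Finite G] {p : ℕ} [Fact p.Prime]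
    {P D : Subgroup G} (hP : IsPGroup p P) (hD : D < P) :
    ∃ a ∈ P, a ∈ normalizer (D : Set G) ∧ a ∉ D := by
  have hnil : Group.IsNilpotent P := hP.isNilpotent
  have hlt : D.subgroupOf P < ⊤ := lt_top_iff_ne_top.mpr fun h => hD.not_ge (subgroupOf_eq_top.mp h)
  obtain ⟨a, ha, hna⟩ := SetLike.exists_of_lt (Group.normalizerCondition_of_isNilpotent _ hlt)
  refine ⟨a, a.2, ?_, hna⟩
  rw [mem_normalizer_iff] at ha ⊢
  intro h
  constructor
  · intro hh
    exact (ha ⟨h, hD.le hh⟩).mp hh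
  · intro hh
    have hhP : h ∈ P := by
      have := P.mul_mem (P.mul_mem (P.inv_mem a.2) (hD.le hh)) a.2
      simpa [mul_assoc] using this
    exact (ha ⟨h, hhP⟩).mpr hh

/-- If `p'`-elements normalizing a `p`-subgroup always centralize it, then any two Sylow
`p`-subgroups are conjugate by an element centralizing their intersection. -/
theorem Sylow.exists_mem_centralizer_inf_smul_eq [Group G] [Finite G] {p : ℕ} [Fact p.Prime]
    (hF : ∀ Q : Subgroup G, IsPGroup p Q → ∀ y ∈ normalizer (Q : Set G), (orderOf y).Coprime p →
      y ∈ centralizer (Q : Set G)) (P R : Sylow p G) :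
    ∃ c ∈ centralizer ((P ⊓ R : Subgroup G) : Set G), c • P = R := by
  induction hm : Nat.card G - Nat.card (P ⊓ R : Subgroup G) using Nat.strong_induction_on
    generalizing P R with
  | _ m ih =>
  subst hm
  by_cases hPR : P = R
  · exact ⟨1, one_mem _, by rw [one_smul, hPR]⟩
  obtain ⟨D, hDdef⟩ : ∃ D : Subgroup G, D = (P : Subgroup G) ⊓ R := ⟨_, rfl⟩
  have hDP : D < P := lt_of_le_of_ne (hDdef ▸ inf_le_left) fun h =>
    hPR (Sylow.ext (P.3 R.2 (inf_eq_left.mp (hDdef ▸ h))).symm)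
  have hDR : D < R := lt_of_le_of_ne (hDdef ▸ inf_le_right) fun h =>
    hPR (Sylow.ext (R.3 P.2 (inf_eq_right.mp (hDdef ▸ h))))
  have hDp : IsPGroup p D := P.2.to_le hDP.le
  have hDn : D ≤ normalizer (D : Set G) := le_normalizer
  obtain ⟨a, haP, haN, haD⟩ := P.2.exists_mem_normalizer_notMem hDP
  obtain ⟨b, hbR, hbN, hbD⟩ := R.2.exists_mem_normalizer_notMem hDR
  obtain ⟨P₁, hP₁⟩ := (P.2.comap_subtype (K := normalizer (D : Set G))).exists_le_sylow
  obtain ⟨R₁, hR₁⟩ := (R.2.comap_subtype (K := normalizer (D : Set G))).exists_le_sylow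
  obtain ⟨n, hn⟩ := MulAction.exists_smul_eq (normalizer (D : Set G)) P₁ R₁
  obtain ⟨c, hc, s, hs, rfl⟩ := exists_eq_centralizer_mul_sylow (hF D hDp) P₁ n
  have hcP : c • P₁ = R₁ := by
    rw [← hn, mul_smul, Sylow.smul_eq_iff_mem_normalizer.mpr (le_normalizer hs)]
  obtain ⟨T, hT⟩ := (P₁.2.map (normalizer (D : Set G)).subtype).exists_le_sylow
  have key : ∀ A B : Sylow p G, D ≤ A → D ≤ B → ∀ a, a ∈ A → a ∈ B → a ∉ D →
      ∃ c ∈ centralizer (D : Set G), c • A = B := by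
    intro A B hA hB a haA haB haD
    have hlt : D < (A : Subgroup G) ⊓ B := SetLike.lt_iff_le_and_exists.mpr
      ⟨le_inf hA hB, a, mem_inf.mpr ⟨haA, haB⟩, haD⟩
    have h1 : Nat.card D < Nat.card ((A : Subgroup G) ⊓ B : Subgroup G) := by
      refine lt_of_le_of_ne (card_le_of_le hlt.le) fun h => hlt.ne ?_
      exact eq_of_le_of_card_ge hlt.le h.ge
    have h2 := Subgroup.card_le_card_group ((A : Subgroup G) ⊓ B)
    obtain ⟨c, hc, h⟩ := ih _ (by rw [← hDdef]; omega) A B rfl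
    exact ⟨c, centralizer_le hlt.le hc, h⟩
  have hPT : ∀ x ∈ P, x ∈ normalizer (D : Set G) → x ∈ T := fun x hx hxN =>
    hT ⟨⟨x, hxN⟩, hP₁ hx, rfl⟩
  have hRT : ∀ x ∈ R, x ∈ normalizer (D : Set G) → x ∈ (c : G) • T := by
    intro x hx hxN
    have hx1 : (⟨x, hxN⟩ : normalizer (D : Set G)) ∈ c • P₁ := by
      rw [hcP]; exact hR₁ hx
    obtain ⟨y, hy, hyx⟩ := hx1
    exact ⟨y, hT ⟨y, hy, rfl⟩, congrArg Subtype.val hyx⟩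
  obtain ⟨c₁, hc₁, h₁⟩ := key P T hDP.le (fun x hx => hPT x (hDP.le hx) (hDn hx)) a haP
    (hPT a haP haN) haD
  obtain ⟨c₂, hc₂, h₂⟩ := key ((c : G) • T) R (fun x hx => hRT x (hDR.le hx) (hDn hx)) hDR.le b
    (hRT b hbR hbN) hbR hbD
  refine ⟨c₂ * c * c₁, ?_, by rw [mul_smul, mul_smul, h₁, h₂]⟩
  rw [← hDdef]
  exact mul_mem (mul_mem hc₂ hc) hc₁

open scoped commutatorElement in
/-- Under Frobenius' condition, the focal subgroup of a Sylow subgroup is its derived subgroup. -/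
theorem Sylow.focalSubgroupOf_le_commutator [Group G] [Finite G] {p : ℕ} [Fact p.Prime]
    (hF : ∀ Q : Subgroup G, IsPGroup p Q → ∀ y ∈ normalizer (Q : Set G), (orderOf y).Coprime p →
      y ∈ centralizer (Q : Set G)) (P : Sylow p G) :
    (P : Subgroup G).focalSubgroupOf ≤ commutator P := by
  rw [focalSubgroupOf_eq_closure, closure_le]
  rintro g ⟨x, hx, u, hg⟩
  have hyP : u * x⁻¹ * u⁻¹ ∈ (P : Subgroup G) := by
    have := mul_mem (inv_mem hx) g.2
    rw [hg, commutatorElement_def] at this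
    simpa [mul_assoc] using this
  obtain ⟨c, hc, hcP⟩ := Sylow.exists_mem_centralizer_inf_smul_eq hF (u • P) P
  have hcN : c * u ∈ normalizer ((P : Subgroup G) : Set G) :=
    Sylow.smul_eq_iff_mem_normalizer.mp (by rw [mul_smul, hcP])
  obtain ⟨d, hd, s, hs, hds⟩ := exists_eq_centralizer_mul_sylow (hF P P.2)
    (P.subtype le_normalizer) ⟨c * u, hcN⟩
  have hds' : c * u = d * s := congrArg Subtype.val hds
  have hsP : (s : G) ∈ P := hs
  have h1 : c * (u * x⁻¹ * u⁻¹) * c⁻¹ = u * x⁻¹ * u⁻¹ := by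
    rw [mul_inv_eq_iff_eq_mul]
    exact (mem_centralizer_iff.mp hc _ ⟨⟨x⁻¹, inv_mem hx, rfl⟩, hyP⟩).symm
  have h2 : (d : G) * (s * x⁻¹ * (s : G)⁻¹) * (d : G)⁻¹ = s * x⁻¹ * (s : G)⁻¹ := by
    rw [mul_inv_eq_iff_eq_mul]
    exact (mem_centralizer_iff.mp hd _ (mul_mem (mul_mem hsP (inv_mem hx)) (inv_mem hsP))).symm
  have h3 : u * x⁻¹ * u⁻¹ = s * x⁻¹ * (s : G)⁻¹ := by
    rw [← h1, ← h2]
    calc c * (u * x⁻¹ * u⁻¹) * c⁻¹ = (c * u) * x⁻¹ * (c * u)⁻¹ := by group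
      _ = _ := by rw [hds']; group
  have h4 : g = ⁅(⟨x, hx⟩ : (P : Subgroup G)), (⟨s, hsP⟩ : (P : Subgroup G))⁆ := by
    apply Subtype.ext
    rw [hg, commutatorElement_def, commutatorElement_def]
    change x * u * x⁻¹ * u⁻¹ = x * s * x⁻¹ * (s : G)⁻¹
    simpa [mul_assoc] using congrArg (x * ·) h3
  rw [h4]
  exact commutator_mem_commutator (mem_top _) (mem_top _)

/-- Itô: if `p` is odd and all elements of order `p` are central, then the `p'`-elements form
a subgroup. -/
theorem exists_subgroup_mem_iff_orderOf_coprime [Group G] [Finite G] {p : ℕ} [Fact p.Prime]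
    (hp2 : p ≠ 2) (hz : ∀ z : G, z ^ p = 1 → ∀ g, g * z = z * g) :
    ∃ N : Subgroup G, ∀ g, g ∈ N ↔ (orderOf g).Coprime p := by
  induction hm : Nat.card G using Nat.strong_induction_on generalizing G with
  | _ m ih =>
  subst hm
  by_cases hpG : p ∣ Nat.card G
  swap
  · refine ⟨⊤, fun g => iff_of_true (mem_top g) ?_⟩
    exact Nat.Coprime.coprime_dvd_left (orderOf_dvd_natCard g)
      ((Fact.out : p.Prime).coprime_iff_not_dvd.mpr hpG).symm
  let P : Sylow p G := default
  have hP1 : Nontrivial P := (Subgroup.nontrivial_iff_ne_bot _).mpr (P.ne_bot_of_dvd_card hpG)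
  have hPnil : Group.IsNilpotent P := P.2.isNilpotent
  have hfoc : (P : Subgroup G).focalSubgroupOf < ⊤ :=
    (P.focalSubgroupOf_le_commutator
      (mem_centralizer_of_mem_normalizer_of_coprime hp2 hz)).trans_lt
      (Group.IsSolvable.commutator_lt_top_of_nontrivial P)
  let K : Subgroup G := (P : Subgroup G).transferFocal.ker
  have hK : K ≠ ⊤ := by
    intro h
    refine hfoc.ne (top_le_iff.mp fun x _ => ?_)
    obtain ⟨g, hg⟩ := transferFocal_surjective P (QuotientGroup.mk x)
    have hgK : g ∈ K := h ▸ mem_top g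
    rw [← QuotientGroup.eq_one_iff, ← hg]
    exact hgK
  obtain ⟨M, hM⟩ := ih (Nat.card K) (lt_of_le_of_ne (Subgroup.card_le_card_group K)
    fun h => hK (Subgroup.eq_top_of_card_eq K h)) (G := K)
    (fun z hzp g => Subtype.ext (hz z (by rw [← Subgroup.coe_pow, hzp, Subgroup.coe_one]) g)) rfl
  refine ⟨M.map K.subtype, fun g => ⟨?_, fun hg => ?_⟩⟩
  · rintro ⟨k, hk, rfl⟩
    rw [K.coe_subtype, Subgroup.orderOf_coe]
    exact (hM k).mp hk
  · have hgK : g ∈ K := by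
      have hQ : IsPGroup p (P ⧸ (P : Subgroup G).focalSubgroupOf) := P.2.to_quotient _
      refine orderOf_eq_one_iff.mp (Nat.eq_one_of_dvd_coprimes (hQ.orderOf_coprime hg.symm
        ((P : Subgroup G).transferFocal g)) dvd_rfl (orderOf_map_dvd _ g))
    exact ⟨⟨g, hgK⟩, (hM _).mpr (by rwa [← Subgroup.orderOf_coe]), rfl⟩

/-- If all subgroups of prime order are normal, the elements of prime order are centralized by the
derived subgroup. -/
theorem commute_of_mem_commutator_of_pow_eq_one [Group G]
    (h : ∀ H : Subgroup G, (∃ q : ℕ, q.Prime ∧ Nat.card H = q) → H.Normal) {p : ℕ}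
    (hp : p.Prime) {z : G} (hz : z ^ p = 1) {g : G} (hg : g ∈ commutator G) : g * z = z * g := by
  by_cases hz1 : z = 1
  · simp [hz1]
  have := Fact.mk hp
  have hn : (zpowers z).Normal := h _ ⟨p, hp, by rw [Nat.card_zpowers, orderOf_eq_prime hz hz1]⟩
  have hconj : ∀ a : G, ∃ k : ℤ, a * z * a⁻¹ = z ^ k := fun a => by
    obtain ⟨k, hk⟩ := hn.conj_mem z (mem_zpowers z) a
    exact ⟨k, hk.symm⟩
  have hcomm : ∀ a b : G, (a * b) * z * (a * b)⁻¹ = (b * a) * z * (b * a)⁻¹ := by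
    intro a b
    obtain ⟨k, hk⟩ := hconj a
    obtain ⟨l, hl⟩ := hconj b
    calc (a * b) * z * (a * b)⁻¹ = a * (b * z * b⁻¹) * a⁻¹ := by group
      _ = b * (a * z * a⁻¹) * b⁻¹ := by
        rw [hl, ← conj_zpow, hk, ← conj_zpow, hl, ← zpow_mul, ← zpow_mul, mul_comm]
      _ = (b * a) * z * (b * a)⁻¹ := by group
  have hle : commutator G ≤ centralizer {z} := by
    rw [commutator_def, commutator_le]
    intro a _ b _
    rw [mem_centralizer_singleton_iff, commutatorElement_def]
    calc a * b * a⁻¹ * b⁻¹ * z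
        = a * b * ((a⁻¹ * b⁻¹) * z * (a⁻¹ * b⁻¹)⁻¹) * (b * a)⁻¹ := by group
      _ = z * (a * b * a⁻¹ * b⁻¹) := by rw [hcomm]; group
  exact mem_centralizer_singleton_iff.mp (hle hg)

theorem leHypercenterOver_top_of_isNilpotent_quotient [Group G] (S : Subgroup G) [S.Normal]
    [Group.IsNilpotent (G ⧸ S)] : LeHypercenterOver S ⊤ := by
  obtain ⟨n, hn⟩ := Group.IsNilpotent.nilpotent (G ⧸ S)
  refine ⟨n, fun i => (Subgroup.upperCentralSeries (G ⧸ S) i).comap (QuotientGroup.mk' S), ?_, ?_, ?_⟩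
  · simp
  · simp [hn]
  · intro i _
    refine ⟨comap_mono (Subgroup.upperCentralSeries_mono _ i.le_succ), fun z hz g => ?_⟩
    exact Subgroup.mem_upperCentralSeries_succ_iff.mp hz (QuotientGroup.mk' S g)

/-- If for each odd prime `p` the `p'`-elements form a subgroup, then the group has a normal Sylow
`2`-subgroup with nilpotent quotient. -/
theorem exists_normal_two_subgroup_isNilpotent_quotient [Group G] [Finite G]
    (h : ∀ p : ℕ, p.Prime → p ≠ 2 → ∃ N : Subgroup G, ∀ g, g ∈ N ↔ (orderOf g).Coprime p) :
    ∃ (S : Subgroup G) (_ : S.Normal), IsPGroup 2 S ∧ ¬ 2 ∣ S.index ∧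
      Group.IsNilpotent (G ⧸ S) := by
  let I := {p : ℕ // p ∈ (Nat.card G).primeFactors ∧ p ≠ 2}
  have : Finite I := Finite.of_injective
    (fun i : I => (⟨i.1, i.2.1⟩ : {p // p ∈ (Nat.card G).primeFactors}))
    fun i j hij => Subtype.ext (congrArg (fun x => x.1) hij)
  have hI : ∀ i : I, i.1.Prime := fun i => Nat.prime_of_mem_primeFactors i.2.1
  choose N hN using fun i : I => h i.1 (hI i) i.2.2
  have hNn : ∀ i, (N i).Normal := fun i => ⟨fun n hn g => by
    rw [hN] at hn ⊢
    rwa [show orderOf (g * n * g⁻¹) = orderOf n from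
      MulEquiv.orderOf_eq (MulAut.conj g) n]⟩
  have hnil : ∀ i, Group.IsNilpotent (G ⧸ N i) := fun i => by
    have := Fact.mk (hI i)
    exact (isPGroup_quotient_of_coprime_mem (N i) fun y hy => (hN i y).mpr hy).isNilpotent
  let f : G →* (∀ i, G ⧸ N i) := MonoidHom.pi fun i => QuotientGroup.mk' (N i)
  have hf : ∀ g, g ∈ f.ker ↔ ∀ i : I, (orderOf g).Coprime i.1 := fun g => by
    rw [MonoidHom.mem_ker, funext_iff]
    exact forall_congr' fun i => (QuotientGroup.eq_one_iff g).trans (hN i g)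
  have hf2 : ∀ g, g ∈ f.ker ↔ ∃ k, g ^ 2 ^ k = 1 := by
    intro g
    rw [hf]
    constructor
    · intro hg
      have hdvd : ∀ q : ℕ, q.Prime → q ∣ orderOf g → q = 2 := by
        intro q hq hqg
        by_contra hq2
        have := hg ⟨q, Nat.mem_primeFactors.mpr ⟨hq, hqg.trans (orderOf_dvd_natCard g),
          Nat.card_pos.ne'⟩, hq2⟩
        exact hq.one_lt.ne' (Nat.eq_one_of_dvd_coprimes this hqg dvd_rfl)
      refine ⟨_, orderOf_dvd_iff_pow_eq_one.mp
        (Nat.eq_prime_pow_of_unique_prime_dvd (orderOf_pos g).ne' (hdvd _ · ·)).dvd⟩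
    · rintro ⟨k, hk⟩ i
      refine Nat.Coprime.coprime_dvd_left (orderOf_dvd_of_pow_eq_one hk) (Nat.Coprime.pow_left k ?_)
      exact (Nat.coprime_primes Nat.prime_two (hI i)).mpr i.2.2.symm
  refine ⟨f.ker, inferInstance, ?_, ?_, ?_⟩
  · rintro ⟨g, hg⟩
    obtain ⟨k, hk⟩ := (hf2 g).mp hg
    exact ⟨k, Subtype.ext hk⟩
  · intro h2
    have : Fact (Nat.Prime 2) := ⟨Nat.prime_two⟩
    obtain ⟨x, hx⟩ := exists_prime_orderOf_dvd_card' (G := G ⧸ f.ker) 2 h2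
    obtain ⟨g, rfl⟩ := QuotientGroup.mk_surjective x
    have hg2 : g ^ 2 ∈ f.ker := by
      rw [← QuotientGroup.eq_one_iff, QuotientGroup.mk_pow, ← hx, pow_orderOf_eq_one]
    obtain ⟨k, hk⟩ := (hf2 _).mp hg2
    have hg : g ∈ f.ker := (hf2 g).mpr ⟨k + 1, by rw [pow_succ', pow_mul, hk]⟩
    rw [(QuotientGroup.eq_one_iff g).mpr hg, orderOf_one] at hx
    norm_num at hx
  · exact (Group.isNilpotent_congr (QuotientGroup.quotientKerEquivRange f)).mpr inferInstance

/-- Gaschütz–Itô: If every minimal subgroup of `G` is normal, then `G`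
is soluble and `G'` has a normal Sylow 2-subgroup with nilpotent factor group. -/
theorem stmt17 [Group G] [Finite G]
    (h : ∀ H : Subgroup G, (∃ q : ℕ, q.Prime ∧ Nat.card H = q) → H.Normal) :
    IsSolvable G ∧ ∃ S : Subgroup ↥(commutator G), S.Normal ∧ IsPGroup 2 S ∧
      ¬ 2 ∣ S.index ∧ LeHypercenterOver S ⊤ := by
  obtain ⟨S, hSn, hS2, hSi, hSnil⟩ := exists_normal_two_subgroup_isNilpotent_quotient
    (G := ↥(commutator G)) fun p hp hp2 => by
      have := Fact.mk hp
      refine exists_subgroup_mem_iff_orderOf_coprime hp2 fun z hz g => Subtype.ext ?_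
      exact commute_of_mem_commutator_of_pow_eq_one h hp
        (by rw [← Subgroup.coe_pow, hz, Subgroup.coe_one]) g.2
  refine ⟨?_, S, hSn, hS2, hSi, leHypercenterOver_top_of_isNilpotent_quotient S⟩
  have : Fact (Nat.Prime 2) := ⟨Nat.prime_two⟩
  have h1 : Group.IsNilpotent S := hS2.isNilpotent
  have h2 : Group.IsSolvable ↥(commutator G) :=
    Group.isSolvable_of_ker_le_range S.subtype (QuotientGroup.mk' S) (by simp)
  exact Group.isSolvable_of_ker_le_range (commutator G).subtype (Abelianization.of : G →* _)
    (by rw [Abelianization.ker_of]; simp)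
end

section
/- (Buckley) If every minimal subgroup of a finite group G of odd order is normal in G, then G is supersoluble. -/
open Subgroup Pointwise

variable {G : Type*}

section PowerMap

open scoped commutatorElement

variable [Group G]

theorem mul_pow_of_central_commutator_s18 {x w d : G} (hwx : w * x = x * w * d)
    (hd : ∀ g, Commute d g) (n : ℕ) : (x * w) ^ n = x ^ n * w ^ n * d ^ n.choose 2 := by
  have hw : ∀ n : ℕ, w ^ n * x = x * w ^ n * d ^ n := fun n ↦ by
    induction n with
    | zero => simp
    | succ n ih =>
      calc w ^ (n + 1) * x = w ^ n * (w * x) := by rw [pow_succ, mul_assoc]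
        _ = (w ^ n * x) * (w * d) := by rw [hwx]; simp only [mul_assoc]
        _ = x * w ^ n * (d ^ n * w) * d := by rw [ih]; simp only [mul_assoc]
        _ = x * w ^ (n + 1) * d ^ (n + 1) := by
          rw [((hd w).pow_left n).eq, pow_succ, pow_succ]; simp only [mul_assoc]
  induction n with
  | zero => simp
  | succ n ih =>
    calc (x * w) ^ (n + 1) = x ^ n * w ^ n * (d ^ n.choose 2 * (x * w)) := by
          rw [pow_succ, ih]; simp only [mul_assoc]
      _ = x ^ n * (w ^ n * x) * w * d ^ n.choose 2 := by
          rw [((hd (x * w)).pow_left _).eq]; simp only [mul_assoc]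
      _ = x ^ n * x * w ^ n * (d ^ n * w) * d ^ n.choose 2 := by
          rw [hw]; simp only [mul_assoc]
      _ = x ^ (n + 1) * w ^ (n + 1) * d ^ (n + 1).choose 2 := by
          rw [((hd w).pow_left n).eq, Nat.choose_succ_succ' n 1, Nat.choose_one_right, pow_add d,
            pow_succ x n, pow_succ w n]
          simp only [mul_assoc]

theorem inv_mul_pow_eq_one_of_pow_eq_pow [Group.IsNilpotent G] {p : ℕ} (hp : Odd p)
    (hc : ∀ z : G, z ^ p = 1 → ∀ g, Commute z g) {x y : G} (hxy : x ^ p = y ^ p) :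
    (x⁻¹ * y) ^ p = 1 := by
  obtain ⟨n, hn⟩ := Subgroup.nilpotent_iff_lowerCentralSeries.mp ‹Group.IsNilpotent G›
  suffices H : ∀ m i, i + m = n → ∀ y : G, x ^ p = y ^ p →
      x⁻¹ * y ∈ (⊤ : Subgroup G).lowerCentralSeries i → (x⁻¹ * y) ^ p = 1 from
    H n 0 (by simp) y hxy (by simp)
  intro m
  induction m with
  | zero =>
    rintro i rfl y - hi
    rw [add_zero] at hn
    rw [hn, mem_bot] at hi
    rw [hi, one_pow]
  | succ m ih =>
    intro i him y hxy hi
    have hconj : x ^ p = (y⁻¹ * x * y) ^ p := by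
      have := conj_pow (i := p) (a := y⁻¹) (b := x)
      rw [inv_inv] at this
      rw [this, hxy]
      group
    have hmem : x⁻¹ * (y⁻¹ * x * y) ∈ (⊤ : Subgroup G).lowerCentralSeries (i + 1) := by
      have : x⁻¹ * (y⁻¹ * x * y) = ⁅(x⁻¹ * y)⁻¹, x⁻¹⁆⁻¹ := by
        simp only [commutatorElement_def]; group
      rw [this]
      exact inv_mem (commutator_mem_commutator (inv_mem hi) (mem_top x⁻¹))
    have hcp := ih (i + 1) (by omega) _ hconj hmem
    have hd := hc _ hcp
    have key := mul_pow_of_central_commutator_s18 (x := x) (w := x⁻¹ * y)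
      (d := (x⁻¹ * (y⁻¹ * x * y))⁻¹) (by group) (fun g ↦ (hd g).inv_left) p
    have hdp : ((x⁻¹ * (y⁻¹ * x * y))⁻¹) ^ p.choose 2 = 1 := by
      rw [inv_pow, inv_eq_one, Nat.choose_two_right,
        Nat.mul_div_assoc _ (even_iff_two_dvd.mp (hp.tsub_odd odd_one)), pow_mul, hcp, one_pow]
    rw [hdp, mul_one, mul_inv_cancel_left, ← hxy] at key
    exact left_eq_mul.mp key

theorem IsPGroup.inv_mul_pow_eq_one_of_pow_eq_pow [Finite G] {p : ℕ} [Fact p.Prime] (hp : Odd p)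
    {P : Subgroup G} (hP : IsPGroup p P) (hc : ∀ z ∈ P, z ^ p = 1 → ∀ g ∈ P, Commute z g)
    {x y : G} (hx : x ∈ P) (hy : y ∈ P) (hxy : x ^ p = y ^ p) : (x⁻¹ * y) ^ p = 1 := by
  have := hP.isNilpotent
  have := _root_.inv_mul_pow_eq_one_of_pow_eq_pow (G := P) hp
    (fun z hz g ↦ Subtype.ext (hc z z.2 (by simpa using congrArg Subtype.val hz) g g.2))
    (x := ⟨x, hx⟩) (y := ⟨y, hy⟩) (Subtype.ext hxy)
  simpa using congrArg Subtype.val this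

/-- An element of order prime to `p` normalizing a `p`-group centralizes it once it centralizes
its elements of order `p`. -/
theorem IsPGroup.commute_of_coprime_orderOf [Finite G] {p : ℕ} [Fact p.Prime] (hp : Odd p)
    {P : Subgroup G} (hP : IsPGroup p P) (hc : ∀ z ∈ P, z ^ p = 1 → ∀ g ∈ P, Commute z g)
    {k : G} (hk : k ∈ normalizer (P : Set G)) (hkp : (orderOf k).Coprime p)
    (hkc : ∀ z ∈ P, z ^ p = 1 → Commute k z) {x : G} (hx : x ∈ P) : Commute k x := by
  obtain ⟨n, hn⟩ := hP ⟨x, hx⟩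
  replace hn : x ^ p ^ n = 1 := by simpa using congrArg Subtype.val hn
  induction n generalizing x with
  | zero => simp_all
  | succ n ih =>
    have hxp : Commute k (x ^ p) := ih (P.pow_mem hx p) (by rwa [← pow_mul, ← pow_succ'])
    have hkx : k * x * k⁻¹ ∈ P := (mem_normalizer_iff.mp hk x).mp hx
    set z := x⁻¹ * (k * x * k⁻¹) with hz
    have hzP : z ∈ P := P.mul_mem (P.inv_mem hx) hkx
    have hzp : z ^ p = 1 := hP.inv_mul_pow_eq_one_of_pow_eq_pow hp hc hx hkx (by
      rw [conj_pow, hxp.eq, mul_inv_cancel_right])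
    have hpow : ∀ m : ℕ, k ^ m * x = x * z ^ m * k ^ m := fun m ↦ by
      induction m with
      | zero => simp
      | succ m ih =>
        have h1 : k * x = x * z * k := by rw [hz]; group
        have h2 := ((hkc z hzP hzp).pow_left m).eq
        rw [pow_succ, mul_assoc, h1, ← mul_assoc, ← mul_assoc, ih, pow_succ,
          mul_assoc (x * z ^ m), h2]
        simp only [mul_assoc]
    have h1 : z ^ orderOf k = 1 := by
      have := hpow (orderOf k)
      rwa [pow_orderOf_eq_one, one_mul, mul_one, left_eq_mul] at this
    have h2 : z = 1 := by
      have := orderOf_dvd_of_pow_eq_one h1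
      exact orderOf_eq_one_iff.mp
        (Nat.eq_one_of_dvd_coprimes hkp this (orderOf_dvd_of_pow_eq_one hzp))
    have h3 := hpow 1
    rw [h2] at h3
    simpa [Commute, SemiconjBy] using h3

end PowerMap

section PNilpotent

open scoped commutatorElement

variable [Group G] {p : ℕ} [hp : Fact p.Prime]

theorem mem_iff_coprime_orderOf {N : Subgroup G} (hN : ¬ p ∣ Nat.card N)
    (h : ∀ x, ∃ n, x ^ p ^ n ∈ N) {x : G} : x ∈ N ↔ p.Coprime (orderOf x) := by
  refine ⟨fun hx ↦ ?_, fun hx ↦ ?_⟩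
  · exact ((Nat.Prime.coprime_iff_not_dvd hp.out).mpr hN).coprime_dvd_right
      (N.orderOf_dvd_natCard hx)
  · obtain ⟨n, hn⟩ := h x
    obtain ⟨m, hm⟩ := exists_pow_eq_self_of_coprime (hx.pow_left n)
    exact hm ▸ N.pow_mem hn m

variable [Finite G]

theorem pNilpotent_of_pow_mem {N : Subgroup G} (hN : ¬ p ∣ Nat.card N)
    (h : ∀ x, ∃ n, x ^ p ^ n ∈ N) : pNilpotent p G := by
  have hnormal : N.Normal := ⟨fun x hx g ↦ by
    rw [mem_iff_coprime_orderOf hN h] at hx ⊢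
    have : orderOf (g * x * g⁻¹) = orderOf x := by
      simpa using orderOf_injective (MulAut.conj g).toMonoidHom (MulAut.conj g).injective x
    rwa [this]⟩
  refine ⟨N, hnormal, hN, fun q hq hqN ↦ ?_⟩
  have : IsPGroup p (G ⧸ N) := fun x ↦ by
    induction x using QuotientGroup.induction_on with
    | H x =>
      obtain ⟨n, hn⟩ := h x
      exact ⟨n, by rwa [← QuotientGroup.mk_pow, QuotientGroup.eq_one_iff]⟩
  obtain ⟨n, hn⟩ := IsPGroup.iff_card.mp this
  rw [index_eq_card, hn] at hqN
  exact (Nat.prime_dvd_prime_iff_eq hq hp.out).mp (hq.dvd_of_dvd_pow hqN)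

theorem pNilpotent.exists_pow_mem (h : pNilpotent p G) :
    ∃ N : Subgroup G, N.Normal ∧ ¬ p ∣ Nat.card N ∧ ∀ x, ∃ n, x ^ p ^ n ∈ N := by
  obtain ⟨N, hN, hNp, hq⟩ := h
  have hP : IsPGroup p (G ⧸ N) := by
    rw [isPGroup_iff_primeFactors_card_subset hp.out.ne_zero, ← index_eq_card,
      hp.out.primeFactors]
    intro q hqN
    rw [Finset.mem_singleton]
    exact hq q (Nat.prime_of_mem_primeFactors hqN) (Nat.dvd_of_mem_primeFactors hqN)
  refine ⟨N, hN, hNp, fun x ↦ ?_⟩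
  obtain ⟨n, hn⟩ := hP (x : G ⧸ N)
  exact ⟨n, by rwa [← QuotientGroup.mk_pow, QuotientGroup.eq_one_iff] at hn⟩

/-- A group is `p`-nilpotent as soon as it has a `p`-nilpotent subgroup containing a `p`-power
of every element. -/
theorem pNilpotent.of_subgroup {M : Subgroup G} (hM : pNilpotent p M)
    (h : ∀ x, ∃ n, x ^ p ^ n ∈ M) : pNilpotent p G := by
  obtain ⟨N, -, hN, hpow⟩ := hM.exists_pow_mem
  refine pNilpotent_of_pow_mem (N := N.map M.subtype) ?_ fun x ↦ ?_
  · rwa [card_map_of_injective M.subtype_injective]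
  · obtain ⟨n, hn⟩ := h x
    obtain ⟨m, hm⟩ := hpow ⟨_, hn⟩
    exact ⟨n + m, _, hm, by simp [pow_add, pow_mul]⟩

theorem exists_eq_mul_of_pow_mem {N : Subgroup G} [N.Normal] (h : ∀ x, ∃ n, x ^ p ^ n ∈ N)
    (S : Sylow p G) (g : G) : ∃ k ∈ N, ∃ s ∈ S, g = k * s := by
  have hP : IsPGroup p (G ⧸ N) := fun x ↦ by
    induction x using QuotientGroup.induction_on with
    | H x =>
      obtain ⟨n, hn⟩ := h x
      exact ⟨n, by rwa [← QuotientGroup.mk_pow, QuotientGroup.eq_one_iff]⟩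
  obtain ⟨n, hn⟩ := IsPGroup.iff_card.mp hP
  rw [← index_eq_card] at hn
  have htop : N ⊔ S = ⊤ := by
    rw [← index_eq_one]
    refine Nat.eq_one_of_dvd_coprimes (a := N.index) (b := (S : Subgroup G).index) ?_
      (index_dvd_of_le le_sup_left) (index_dvd_of_le le_sup_right)
    rw [hn]
    exact (((Nat.Prime.coprime_iff_not_dvd hp.out).mpr S.not_dvd_index)).pow_left n
  have hg : g ∈ N ⊔ S := htop ▸ mem_top g
  rw [← SetLike.mem_coe, normal_mul, Set.mem_mul] at hg
  obtain ⟨k, hk, s, hs, rfl⟩ := hg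
  exact ⟨k, hk, s, hs, rfl⟩

theorem exists_smul_sylow_eq_of_pow_mem {N : Subgroup G} [N.Normal]
    (h : ∀ x, ∃ n, x ^ p ^ n ∈ N) (S T : Sylow p G) : ∃ k ∈ N, k • S = T := by
  obtain ⟨g, rfl⟩ := MulAction.exists_smul_eq G S T
  obtain ⟨k, hk, s, hs, rfl⟩ := exists_eq_mul_of_pow_mem h S g
  refine ⟨k, hk, ?_⟩
  rw [mul_smul, Sylow.smul_eq_iff_mem_normalizer.mpr (le_normalizer hs)]

theorem commute_of_not_dvd_card_of_isPGroup {N D : Subgroup G} [N.Normal] [D.Normal]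
    (hN : ¬ p ∣ Nat.card N) (hD : IsPGroup p D) {k d : G} (hk : k ∈ N) (hd : d ∈ D) :
    Commute k d := by
  obtain ⟨n, hn⟩ := IsPGroup.iff_card.mp hD
  refine commute_of_normal_of_disjoint N D ‹_› ‹_› (disjoint_of_coprime_natCard ?_) k d hk hd
  rw [hn]
  exact ((Nat.Prime.coprime_iff_not_dvd hp.out).mpr hN).symm.pow_right n

theorem IsPGroup.exists_mem_normalizer_notMem_s18 {D S : Subgroup G} (hS : IsPGroup p S)
    (hDS : D < S) : ∃ s ∈ S, s ∈ normalizer (D : Set G) ∧ s ∉ D := by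
  have := hS.isNilpotent
  have hlt : D.subgroupOf S < ⊤ := by
    rw [lt_top_iff_ne_top, Ne, subgroupOf_eq_top]
    exact hDS.not_ge
  obtain ⟨s, hs, hsD⟩ := SetLike.exists_of_lt (Group.normalizerCondition_of_isNilpotent _ hlt)
  refine ⟨s, s.2, mem_normalizer_iff.mpr fun x ↦ ?_, fun h ↦ hsD (mem_subgroupOf.mpr h)⟩
  refine ⟨fun hx ↦ ?_, fun hx ↦ ?_⟩
  · exact mem_subgroupOf.mp ((mem_normalizer_iff.mp hs ⟨x, hDS.le hx⟩).mp hx)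
  · have hxS : x ∈ S := by
      have := S.mul_mem (S.mul_mem (S.inv_mem s.2) (hDS.le hx)) s.2
      simpa [mul_assoc] using this
    exact mem_subgroupOf.mp ((mem_normalizer_iff.mp hs ⟨x, hxS⟩).mpr hx)

/-- If the normalizers of the `p`-subgroups not contained in `Q` are `p`-nilpotent, two Sylow
`p`-subgroups are conjugate by an element centralizing their intersection modulo `Q`. -/
theorem exists_smul_sylow_eq_of_pNilpotent_normalizer {Q : Subgroup G} [hQ : Q.Normal]
    (h : ∀ D : Subgroup G, IsPGroup p D → D ≤ Q ∨ pNilpotent p (normalizer (D : Set G)))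
    (S T : Sylow p G) : ∃ c : G, c • S = T ∧ ∀ d ∈ S, d ∈ T → ⁅c, d⁆ ∈ Q := by
  obtain ⟨n, hn⟩ : ∃ n, Nat.card G ≤ Nat.card (S ⊓ T : Subgroup G) + n :=
    ⟨Nat.card G, Nat.le_add_left ..⟩
  induction n generalizing S T with
  | zero =>
    have htop : (S ⊓ T : Subgroup G) = ⊤ := eq_top_of_le_card _ hn
    rw [inf_eq_top_iff] at htop
    refine ⟨1, ?_, fun d _ _ ↦ by simp⟩
    rw [one_smul]
    exact Sylow.ext (htop.1.trans htop.2.symm)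
  | succ n ih =>
    set D : Subgroup G := S ⊓ T with hDdef
    have hDp : IsPGroup p D := S.2.to_le inf_le_left
    rcases h D hDp with hDQ | hD
    · obtain ⟨c, hc⟩ := MulAction.exists_smul_eq G S T
      refine ⟨c, hc, fun d hdS hdT ↦ ?_⟩
      have hd : d ∈ Q := hDQ ⟨hdS, hdT⟩
      rw [commutatorElement_def]
      exact Q.mul_mem (hQ.conj_mem d hd c) (Q.inv_mem hd)
    by_cases hST : S = T
    · exact ⟨1, by rw [one_smul, hST], fun d _ _ ↦ by simp⟩
    have hDS : D < S := inf_le_left.lt_of_ne fun hD ↦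
      hST (Sylow.ext (S.3 T.2 (inf_eq_left.mp hD)).symm)
    have hDT : D < T := inf_le_right.lt_of_ne fun hD ↦
      hST (Sylow.ext (T.3 S.2 (inf_eq_right.mp hD)))
    obtain ⟨s, hsS, hsN, hsD⟩ := S.2.exists_mem_normalizer_notMem_s18 hDS
    obtain ⟨t, htT, htN, htD⟩ := T.2.exists_mem_normalizer_notMem_s18 hDT
    set N : Subgroup G := normalizer (D : Set G) with hNdef
    have hDN : D ≤ N := le_normalizer
    obtain ⟨K, hKnormal, hKp, hKpow⟩ := hD.exists_pow_mem
    obtain ⟨S', hS'⟩ := (S.2.comap_subtype (K := N)).exists_le_sylow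
    obtain ⟨T', hT'⟩ := (T.2.comap_subtype (K := N)).exists_le_sylow
    obtain ⟨k, hkK, hkST⟩ := exists_smul_sylow_eq_of_pow_mem hKpow S' T'
    obtain ⟨U, hU⟩ := (S'.2.map N.subtype).exists_le_sylow
    have hUS : ∀ x ∈ S, x ∈ N → x ∈ U := fun x hx hxN ↦ hU ⟨⟨x, hxN⟩, hS' hx, rfl⟩
    have hUT : ∀ x ∈ T, x ∈ N → x ∈ (k : G) • U := fun x hx hxN ↦ by
      have : (⟨x, hxN⟩ : N) ∈ T' := hT' hx
      rw [← hkST] at this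
      obtain ⟨y, hy, hyx⟩ := this
      exact ⟨y, hU ⟨y, hy, rfl⟩, congrArg Subtype.val hyx⟩
    have hcard : ∀ {A B : Sylow p G} {x : G}, D ≤ A → D ≤ B → x ∈ A → x ∈ B → x ∉ D →
        Nat.card G ≤ Nat.card (A ⊓ B : Subgroup G) + n := fun {A B x} hA hB hxA hxB hxD ↦ by
      have hlt : D < (A ⊓ B : Subgroup G) :=
        lt_of_le_of_ne (le_inf hA hB) fun he ↦ hxD (he ▸ ⟨hxA, hxB⟩)
      have : Nat.card D < Nat.card (A ⊓ B : Subgroup G) := by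
        by_contra! hle
        exact hlt.ne (eq_of_le_of_card_ge hlt.le hle)
      omega
    have hDU : D ≤ U := fun x hx ↦ hUS x (hDS.le hx) (hDN hx)
    have hDkU : D ≤ ((k : G) • U : Sylow p G) := fun x hx ↦ hUT x (hDT.le hx) (hDN hx)
    obtain ⟨a, haU, ha⟩ := ih S U (hcard hDS.le hDU hsS (hUS s hsS hsN) hsD)
    obtain ⟨b, hbT, hb⟩ := ih ((k : G) • U) T (hcard hDkU hDT.le (hUT t htT htN) htT htD)
    have hmul : ∀ {c c' d : G}, ⁅c, d⁆ ∈ Q → ⁅c', d⁆ ∈ Q → ⁅c * c', d⁆ ∈ Q := fun {c c' d} h h' ↦ by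
      have : ⁅c * c', d⁆ = c * ⁅c', d⁆ * c⁻¹ * ⁅c, d⁆ := by
        simp only [commutatorElement_def]; group
      rw [this]
      exact Q.mul_mem (hQ.conj_mem _ h' c) h
    refine ⟨b * (k * a), by rw [mul_smul, mul_smul, haU, hbT], fun d hdS hdT ↦ ?_⟩
    have hd : d ∈ D := ⟨hdS, hdT⟩
    refine hmul (hb d (hDkU hd) hdT) (hmul ?_ (ha d hdS (hDU hd)))
    have : (D.subgroupOf N).Normal := normal_in_normalizer
    have hkd := commute_of_not_dvd_card_of_isPGroup (D := D.subgroupOf N) (d := ⟨d, hDN hd⟩) hKp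
      hDp.comap_subtype hkK hd
    have : ⁅(k : G), d⁆ = 1 := commutatorElement_eq_one_iff_mul_comm.mpr
      (congrArg Subtype.val hkd.eq)
    exact this ▸ Q.one_mem

theorem focalSubgroup_le_commutator_sup {Q : Subgroup G} [Q.Normal]
    (h : ∀ D : Subgroup G, IsPGroup p D → D ≤ Q ∨ pNilpotent p (normalizer (D : Set G)))
    (P : Sylow p G) (hP : pNilpotent p (normalizer (P : Set G))) :
    (P : Subgroup G).focalSubgroup ≤ ⁅(P : Subgroup G), (P : Subgroup G)⁆ ⊔ Q := by
  rw [focalSubgroup_def, closure_le]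
  rintro _ ⟨hxu, x, hx, u, rfl⟩
  set y := u * x * u⁻¹ with hy
  have hyP : y ∈ P := by
    have := P.mul_mem (P.inv_mem hxu) hx
    rwa [commutatorElement_def, show (x * u * x⁻¹ * u⁻¹)⁻¹ * x = y by rw [hy]; group] at this
  obtain ⟨c, hc, hcQ⟩ := exists_smul_sylow_eq_of_pNilpotent_normalizer h (u • P) P
  have hcy := hcQ y ⟨x, hx, rfl⟩ hyP
  rw [← mul_smul, Sylow.smul_eq_iff_mem_normalizer] at hc
  obtain ⟨K, hKnormal, hKp, hKpow⟩ := hP.exists_pow_mem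
  have hPN : (P : Subgroup G) ≤ normalizer (P : Set G) := le_normalizer
  obtain ⟨k, hk, v, hv, hkv⟩ := exists_eq_mul_of_pow_mem hKpow (P.subtype hPN) ⟨c * u, hc⟩
  replace hv : (v : G) ∈ P := hv
  replace hkv : c * u = k * v := congrArg Subtype.val hkv
  have : ((P : Subgroup G).subgroupOf (normalizer (P : Set G))).Normal := normal_in_normalizer
  have hvx : (v : G) * x * (v : G)⁻¹ ∈ P := P.mul_mem (P.mul_mem hv hx) (P.inv_mem hv)
  have hkc := commute_of_not_dvd_card_of_isPGroup
    (D := (P : Subgroup G).subgroupOf (normalizer (P : Set G))) (d := ⟨_, hPN hvx⟩) hKp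
    P.2.comap_subtype hk hvx
  replace hkc : (k : G) * (v * x * (v : G)⁻¹) = v * x * (v : G)⁻¹ * k := congrArg Subtype.val hkc.eq
  have hcyc : c * y * c⁻¹ = v * x * (v : G)⁻¹ :=
    calc c * y * c⁻¹ = (c * u) * x * (c * u)⁻¹ := by rw [hy]; group
      _ = (k : G) * (v * x * (v : G)⁻¹) * (k : G)⁻¹ := by rw [hkv]; group
      _ = v * x * (v : G)⁻¹ := by rw [hkc, mul_inv_cancel_right]
  have key : ⁅x, u⁆ = ⁅x, (v : G)⁆ * ⁅c, y⁆ :=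
    calc ⁅x, u⁆ = x * y⁻¹ := by rw [hy, commutatorElement_def]; group
      _ = x * (v * x * (v : G)⁻¹)⁻¹ * (c * y * c⁻¹ * y⁻¹) := by rw [hcyc]; group
      _ = ⁅x, (v : G)⁆ * ⁅c, y⁆ := by simp only [commutatorElement_def]; group
  rw [key]
  exact mul_mem_sup (commutator_mem_commutator hx hv) hcy

theorem IsPGroup.commutator_sup_lt {P Q : Subgroup G} [Q.Normal] (hP : IsPGroup p P)
    (hQP : Q < P) : ⁅P, P⁆ ⊔ Q < P := by
  have := hP.isNilpotent
  refine lt_of_le_of_ne (sup_le (commutator_le_self P) hQP.le) fun he ↦ ?_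
  have hQ : Q.subgroupOf P ≠ ⊤ := by
    rw [Ne, subgroupOf_eq_top]
    exact hQP.not_ge
  have : Nontrivial (P ⧸ Q.subgroupOf P) := QuotientGroup.nontrivial_iff.mpr hQ
  refine (Group.IsSolvable.commutator_lt_top_of_nontrivial (P ⧸ Q.subgroupOf P)).ne ?_
  rw [eq_top_iff]
  rintro x -
  induction x using QuotientGroup.induction_on with
  | H x =>
    have hx : (x : G) ∈ ⁅P, P⁆ ⊔ Q := he.ge x.2
    rw [← SetLike.mem_coe, mul_normal, Set.mem_mul] at hx
    obtain ⟨a, ha, q, hq, hx⟩ := hx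
    rw [← map_subtype_commutator] at ha
    obtain ⟨a, ha, rfl⟩ := ha
    have hxa : (x : P ⧸ Q.subgroupOf P) = a := by
      rw [eq_comm, QuotientGroup.eq, mem_subgroupOf]
      simpa [← hx] using hq
    rw [hxa]
    have := mem_map_of_mem (QuotientGroup.mk' (Q.subgroupOf P)) ha
    rw [_root_.commutator_def, map_commutator] at this
    exact commutator_mono le_top le_top this

/-- **Itô's theorem** -/
theorem pNilpotent_of_central (hodd : Odd p) (hc : ∀ z : G, z ^ p = 1 → ∀ g, Commute z g) :
    pNilpotent p G := by
  obtain ⟨n, hn⟩ : ∃ n, Nat.card G ≤ n := ⟨_, le_rfl⟩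
  induction n generalizing G with
  | zero => exact absurd hn (by simp [Nat.card_pos.ne'])
  | succ n ih =>
    have hsub : ∀ M : Subgroup G, M ≠ ⊤ → pNilpotent p M := fun M hM ↦ by
      refine ih (fun z hz g ↦ Subtype.ext (hc z (by simpa using congrArg Subtype.val hz) g)) ?_
      have : Nat.card M < Nat.card G := by
        by_contra! hle
        exact hM (eq_top_of_le_card _ hle)
      omega
    obtain ⟨P⟩ : Nonempty (Sylow p G) := inferInstance
    by_cases hP : (P : Subgroup G).Normal
    · obtain ⟨K, hK⟩ := exists_right_complement'_of_coprime P.card_coprime_index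
      have hKp : ¬ p ∣ Nat.card K := hK.symm.index_eq_card ▸ P.not_dvd_index
      refine pNilpotent_of_pow_mem hKp fun x ↦ ?_
      obtain ⟨⟨a, k⟩, rfl⟩ := hK.2 x
      obtain ⟨m, hm⟩ := P.2 a
      have hm : (a : G) ^ p ^ m = 1 := by simpa using congrArg Subtype.val hm
      have hka : Commute (k : G) a := by
        refine P.2.commute_of_coprime_orderOf hodd (fun z _ hz g _ ↦ hc z hz g) ?_ ?_
          (fun z _ hz ↦ (hc z hz k).symm) a.2
        · rw [normalizer_eq_top]
          exact mem_top _
        · exact (((Nat.Prime.coprime_iff_not_dvd hp.out).mpr hKp).coprime_dvd_right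
            (K.orderOf_dvd_natCard k.2)).symm
      refine ⟨m, ?_⟩
      change ((a : G) * k) ^ p ^ m ∈ K
      rw [hka.symm.mul_pow, hm, one_mul]
      exact K.pow_mem k.2 _
    · have hQP : (P : Subgroup G).normalCore < P :=
        (normalCore_le _).lt_of_ne fun he ↦ hP (he ▸ normalCore_normal _)
      have hnorm : ∀ D : Subgroup G, ¬ D.Normal → pNilpotent p (normalizer (D : Set G)) :=
        fun D hD ↦ hsub _ fun he ↦ hD (normalizer_eq_top_iff.mp he)
      have hcore : ∀ D : Subgroup G, IsPGroup p D →
          D ≤ (P : Subgroup G).normalCore ∨ pNilpotent p (normalizer (D : Set G)) := fun D hD ↦ by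
        by_cases hDn : D.Normal
        · exact Or.inl (normal_le_normalCore.mpr (hD.le_sylow_of_normal P))
        · exact Or.inr (hnorm D hDn)
      have hfocal := focalSubgroup_le_commutator_sup hcore P (hnorm P hP)
      have hlt := hfocal.trans_lt (P.2.commutator_sup_lt hQP)
      refine (hsub (P : Subgroup G).transferFocal.ker fun he ↦ ?_).of_subgroup fun x ↦ ?_
      · have := ker_transferFocal_inf_eq_focalSubgroup P
        rw [he, top_inf_eq] at this
        exact hlt.ne this.symm
      · obtain ⟨m, hm⟩ := P.2.to_quotient (P : Subgroup G).focalSubgroupOf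
          ((P : Subgroup G).transferFocal x)
        exact ⟨m, by rwa [MonoidHom.mem_ker, map_pow]⟩

end PNilpotent

section PrimeOrderNormal

/-- Every subgroup of prime order is normal, stated for the generators of such subgroups. -/
def PrimeOrderNormal (X : Type*) [Group X] : Prop :=
  ∀ (q : ℕ) (z : X), q.Prime → z ^ q = 1 → (zpowers z).Normal

theorem primeOrderNormal_of_forall_subgroup [Group G]
    (h : ∀ H : Subgroup G, (∃ q : ℕ, q.Prime ∧ Nat.card H = q) → H.Normal) :
    PrimeOrderNormal G := fun q z hq hz ↦ by
  by_cases hz1 : z = 1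
  · rw [hz1, zpowers_one_eq_bot]
    infer_instance
  · have : Fact q.Prime := ⟨hq⟩
    exact h _ ⟨q, hq, by rw [Nat.card_zpowers, orderOf_eq_prime hz hz1]⟩

variable [Group G]

theorem PrimeOrderNormal.subgroup (h : PrimeOrderNormal G) (M : Subgroup G) :
    PrimeOrderNormal M := fun q z hq hz ↦ by
  have hn := h q (z : G) hq (by simpa using congrArg Subtype.val hz)
  have : zpowers z = (zpowers (z : G)).subgroupOf M := by
    ext x
    simp only [mem_subgroupOf, mem_zpowers_iff, Subtype.ext_iff, coe_zpow]
  rw [this]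
  exact hn.subgroupOf M

theorem normal_zpowers_of_conj_mem {z : G} (hz : ∀ g, g * z * g⁻¹ ∈ zpowers z) :
    (zpowers z).Normal := ⟨fun x hx g ↦ by
  obtain ⟨n, rfl⟩ := mem_zpowers_iff.mp hx
  rw [← conj_zpow]
  exact zpow_mem (hz g) n⟩

theorem PrimeOrderNormal.cyclicFactor (h : PrimeOrderNormal G) {q : ℕ} (hq : q.Prime)
    {K H : Subgroup G} (hKH : IsChiefFactor K H) {z : G} (hz : z ^ q = 1) (hzH : z ∈ H)
    (hzK : z ∉ K) : CyclicFactor K H := by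
  obtain ⟨hK, -, hlt, hmin⟩ := hKH
  have := h q z hq hz
  have htop : K ⊔ zpowers z = H := hmin _ inferInstance
    (le_sup_left.lt_of_ne fun he ↦ hzK (he ▸ mem_sup_right (mem_zpowers z)))
    (sup_le hlt.le (zpowers_le.mpr hzH))
  refine ⟨z, hzH, fun x hx ↦ ?_⟩
  rw [← htop, sup_comm, ← SetLike.mem_coe, mul_normal, Set.mem_mul] at hx
  obtain ⟨_, ⟨n, rfl⟩, k, hk, rfl⟩ := hx
  exact ⟨n, by simpa using hk⟩

theorem IsChiefFactor.map_mk {K H N : Subgroup G} [N.Normal] (hKH : IsChiefFactor K H)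
    (hN : ∀ x ∈ H, x ∈ N → x ∈ K) :
    IsChiefFactor (K.map (QuotientGroup.mk' N)) (H.map (QuotientGroup.mk' N)) := by
  obtain ⟨hK, hH, hlt, hmin⟩ := hKH
  have hsurj := QuotientGroup.mk'_surjective N
  refine ⟨hK.map _ hsurj, hH.map _ hsurj, lt_of_le_not_ge (map_mono hlt.le) fun hle ↦
    hlt.not_ge fun x hx ↦ ?_, fun M hM hKM hMH ↦ le_antisymm hMH ?_⟩
  · obtain ⟨k, hk, hkx⟩ := hle (mem_map_of_mem _ hx)
    have hmem : k⁻¹ * x ∈ K := hN _ (H.mul_mem (H.inv_mem (hlt.le hk)) hx)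
      (QuotientGroup.eq.mp hkx)
    simpa using K.mul_mem hk hmem
  · have hle : K ≤ M.comap (QuotientGroup.mk' N) ⊓ H :=
      le_inf (map_le_iff_le_comap.mp hKM.le) hlt.le
    have := hmin (M.comap (QuotientGroup.mk' N) ⊓ H) inferInstance
      (hle.lt_of_ne fun he ↦ ?_) inf_le_right
    · exact map_le_iff_le_comap.mpr (inf_eq_right.mp this)
    · obtain ⟨m, hm, hmK⟩ := SetLike.exists_of_lt hKM
      obtain ⟨x, hx, rfl⟩ := hMH hm
      exact hmK (mem_map_of_mem _ (he.ge ⟨hm, hx⟩))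

theorem CyclicFactor.of_map_mk {K H N : Subgroup G} [N.Normal] (hKH : K ≤ H)
    (hN : ∀ x ∈ H, x ∈ N → x ∈ K)
    (hc : CyclicFactor (K.map (QuotientGroup.mk' N)) (H.map (QuotientGroup.mk' N))) :
    CyclicFactor K H := by
  obtain ⟨_, ⟨g, hg, rfl⟩, hgen⟩ := hc
  refine ⟨g, hg, fun x hx ↦ ?_⟩
  obtain ⟨n, k, hk, hkx⟩ := hgen _ (mem_map_of_mem _ hx)
  refine ⟨n, ?_⟩
  rw [← map_zpow, ← map_inv, ← map_mul] at hkx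
  have hmem : k⁻¹ * ((g ^ n)⁻¹ * x) ∈ K := hN _
    (H.mul_mem (H.inv_mem (hKH hk)) (H.mul_mem (H.inv_mem (H.zpow_mem hg n)) hx))
    (QuotientGroup.eq.mp hkx)
  simpa using K.mul_mem hk hmem

variable [Finite G]

theorem PrimeOrderNormal.commute (h : PrimeOrderNormal G) {q : ℕ} (hq : q.Prime) {z : G}
    (hz : z ^ q = 1) {g : G} (hg : (orderOf g).Coprime (q - 1)) : Commute g z := by
  have := h q z hq hz
  have hcard : Nat.card (MulAut (zpowers z)) ∣ q - 1 := by
    rw [IsCyclic.card_mulAut, Nat.card_zpowers, ← Nat.totient_prime hq]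
    exact Nat.totient_dvd_of_dvd (orderOf_dvd_of_pow_eq_one hz)
  have h1 : MulAut.conjNormal g = (1 : MulAut (zpowers z)) :=
    orderOf_eq_one_iff.mp (Nat.eq_one_of_dvd_coprimes hg (orderOf_map_dvd _ g)
      ((_root_.orderOf_dvd_natCard _).trans hcard))
  have h2 := MulAut.conjNormal_apply g (⟨z, mem_zpowers z⟩ : zpowers z)
  rw [h1, MulAut.one_apply] at h2
  exact (eq_mul_inv_iff_mul_eq.mp h2).symm

/-- Induction along the Sylow tower: some nontrivial Sylow subgroup is normal. -/
theorem PrimeOrderNormal.exists_normal_sylow [Nontrivial G] (hodd : Odd (Nat.card G))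
    (h : PrimeOrderNormal G) : ∃ q : ℕ, q.Prime ∧ (∃ x : G, x ≠ 1 ∧ x ^ q = 1) ∧
      ∃ Q : Subgroup G, ∀ x, x ∈ Q ↔ ∃ n, x ^ q ^ n = 1 := by
  obtain ⟨n, hn⟩ : ∃ n, Nat.card G ≤ n := ⟨_, le_rfl⟩
  induction n generalizing G with
  | zero => exact absurd hn (by simp [Nat.card_pos.ne'])
  | succ n ih =>
    have hp : (Nat.card G).minFac.Prime := Nat.minFac_prime Finite.one_lt_card.ne'
    have hpG := Nat.minFac_dvd (Nat.card G)
    have hcop : (Nat.card G).Coprime ((Nat.card G).minFac - 1) :=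
      Nat.Coprime.symm <| Nat.coprime_of_dvd fun q hq hqp hqG ↦ by
        have := Nat.le_of_dvd (Nat.sub_pos_of_lt hp.one_lt) hqp
        have := Nat.minFac_le_of_dvd hq.two_le hqG
        have := hp.one_lt
        omega
    set p := (Nat.card G).minFac
    have : Fact p.Prime := ⟨hp⟩
    obtain ⟨N, -, hNp, hpow⟩ := (pNilpotent_of_central (G := G) (p := p)
      (hodd.of_dvd_nat hpG) fun z hz g ↦
        (h.commute hp hz (hcop.coprime_dvd_left (_root_.orderOf_dvd_natCard g))).symm).exists_pow_mem
    by_cases hN : N = ⊥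
    · obtain ⟨x, hx⟩ := exists_prime_orderOf_dvd_card' p hpG
      exact ⟨p, hp, ⟨x, (orderOf_eq_prime_iff.mp hx).symm⟩, ⊤, fun x ↦ by simpa [hN] using hpow x⟩
    have : Nontrivial N := (nontrivial_iff_ne_bot N).mpr hN
    have hcard : Nat.card N ≤ n := by
      have : Nat.card N ≠ Nat.card G := fun he ↦ hNp (he ▸ hpG)
      have := card_le_card_group N
      omega
    obtain ⟨q, hq, ⟨y, hy, hyq⟩, Q, hmem⟩ := ih (hodd.of_dvd_nat N.card_subgroup_dvd_card)
      (h.subgroup N) hcard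
    have hqp : p ≠ q := by
      rintro rfl
      exact hNp (orderOf_eq_prime hyq hy ▸ _root_.orderOf_dvd_natCard y)
    refine ⟨q, hq, ⟨y, by simpa using hy, by simpa using congrArg Subtype.val hyq⟩,
      Q.map N.subtype, fun x ↦ ⟨?_, ?_⟩⟩
    · rintro ⟨y, hy, rfl⟩
      obtain ⟨m, hm⟩ := (hmem y).mp hy
      exact ⟨m, by simpa using congrArg Subtype.val hm⟩
    · rintro ⟨m, hm⟩
      have hxN : x ∈ N := (mem_iff_coprime_orderOf hNp hpow).mpr <|
        (((Nat.coprime_primes hp hq).mpr hqp).pow_right m).coprime_dvd_right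
          (orderOf_dvd_of_pow_eq_one hm)
      exact ⟨⟨x, hxN⟩, (hmem _).mpr ⟨m, Subtype.ext hm⟩, rfl⟩

theorem PrimeOrderNormal.quotient (h : PrimeOrderNormal G) {q : ℕ} (hq : q.Prime) (hodd : Odd q)
    {Q N : Subgroup G} (hQ : ∀ x, x ∈ Q ↔ ∃ n, x ^ q ^ n = 1) [N.Normal]
    (hN : ∀ x, x ∈ N ↔ x ^ q = 1) : PrimeOrderNormal (G ⧸ N) := fun r X hr hX ↦ by
  have : Fact q.Prime := ⟨hq⟩
  refine normal_zpowers_of_conj_mem fun Y ↦ ?_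
  induction X using QuotientGroup.induction_on with
  | H x =>
  induction Y using QuotientGroup.induction_on with
  | H g =>
  have hxr : (x ^ r) ^ q = 1 := by
    rwa [← QuotientGroup.mk_pow, QuotientGroup.eq_one_iff, hN] at hX
  have hxq : (x ^ q) ^ r = 1 := by rw [← pow_mul, mul_comm, pow_mul, hxr]
  obtain ⟨k, hk⟩ := mem_zpowers_iff.mp ((h r _ hr hxq).conj_mem _ (mem_zpowers _) g)
  have hk' : (x ^ k) ^ q = (g * x * g⁻¹) ^ q := by
    rw [conj_pow, ← hk, ← zpow_natCast, ← zpow_natCast, ← zpow_mul, ← zpow_mul, mul_comm]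
  by_cases hrq : r = q
  · subst hrq
    have hQp : IsPGroup r Q := fun y ↦ by
      obtain ⟨n, hn⟩ := (hQ y).mp y.2
      exact ⟨n, Subtype.ext (by simpa using hn)⟩
    have hxQ : x ∈ Q := (hQ x).mpr ⟨2, by rw [pow_two, pow_mul, hxr]⟩
    have hyQ : g * x * g⁻¹ ∈ Q := (hQ _).mpr ⟨2, by
      rw [conj_pow, pow_two, pow_mul, hxr, mul_one, mul_inv_cancel]⟩
    have := hQp.inv_mul_pow_eq_one_of_pow_eq_pow hodd (fun z _ hz y hy ↦ by
      obtain ⟨n, hn⟩ := (hQ y).mp hy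
      refine (h.commute hr hz (Nat.Coprime.coprime_dvd_left (orderOf_dvd_of_pow_eq_one hn)
        (Nat.Coprime.pow_left n ?_))).symm
      rw [Nat.coprime_self_sub_right hr.one_le]
      exact Nat.coprime_one_right r) (Q.zpow_mem hxQ k) hyQ hk'
    refine mem_zpowers_iff.mpr ⟨k, ?_⟩
    rw [← QuotientGroup.mk_zpow, ← QuotientGroup.mk_inv, ← QuotientGroup.mk_mul,
      ← QuotientGroup.mk_mul, QuotientGroup.eq, hN]
    exact this
  · have hY : ((g : G ⧸ N) * x * (g : G ⧸ N)⁻¹) ^ r = 1 := by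
      rw [conj_pow, hX, mul_one, mul_inv_cancel]
    have hcop : q.Coprime (orderOf ((g : G ⧸ N) * x * (g : G ⧸ N)⁻¹)) :=
      ((Nat.coprime_primes hq hr).mpr (Ne.symm hrq)).coprime_dvd_right
        (orderOf_dvd_of_pow_eq_one hY)
    obtain ⟨m, hm⟩ := exists_pow_eq_self_of_coprime hcop
    rw [← hm]
    refine pow_mem ?_ m
    have := congrArg (QuotientGroup.mk (s := N)) hk'
    simp only [QuotientGroup.mk_pow, QuotientGroup.mk_zpow, QuotientGroup.mk_mul,
      QuotientGroup.mk_inv] at this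
    rw [← this]
    exact pow_mem (zpow_mem (mem_zpowers _) k) q

theorem PrimeOrderNormal.cyclicFactor_of_isChiefFactor (hodd : Odd (Nat.card G))
    (h : PrimeOrderNormal G) {K H : Subgroup G} (hKH : IsChiefFactor K H) : CyclicFactor K H := by
  obtain ⟨n, hn⟩ : ∃ n, Nat.card G ≤ n := ⟨_, le_rfl⟩
  induction n generalizing G with
  | zero => exact absurd hn (by simp [Nat.card_pos.ne'])
  | succ n ih =>
    have : Nontrivial G := by
      obtain ⟨x, -, hx⟩ := SetLike.exists_of_lt hKH.2.2.1
      exact ⟨x, 1, fun he ↦ hx (he ▸ K.one_mem)⟩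
    obtain ⟨q, hq, ⟨x, hx, hxq⟩, Q, hmem⟩ := h.exists_normal_sylow hodd
    have hcomm : ∀ x y : G, x ^ q = 1 → y ^ q = 1 → Commute x y := fun x y hx hy ↦ by
      refine h.commute hq hy (Nat.Coprime.coprime_dvd_left (orderOf_dvd_of_pow_eq_one hx) ?_)
      rw [Nat.coprime_self_sub_right hq.one_le]
      exact Nat.coprime_one_right q
    let N : Subgroup G :=
      { carrier := {x | x ^ q = 1}
        mul_mem' := fun {x y} hx hy ↦ by
          change (x * y) ^ q = 1
          rw [(hcomm x y hx hy).mul_pow, show x ^ q = 1 from hx, show y ^ q = 1 from hy, one_mul]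
        one_mem' := one_pow q
        inv_mem' := fun {x} hx ↦ by
          change x⁻¹ ^ q = 1
          rw [inv_pow, show x ^ q = 1 from hx, inv_one] }
    have hN : ∀ x, x ∈ N ↔ x ^ q = 1 := fun x ↦ Iff.rfl
    have hNn : N.Normal := ⟨fun x hx g ↦ by
      rw [hN] at hx ⊢
      rw [conj_pow, hx, mul_one, mul_inv_cancel]⟩
    by_cases hHN : ∀ x ∈ H, x ∈ N → x ∈ K
    · have : Fact q.Prime := ⟨hq⟩
      refine CyclicFactor.of_map_mk hKH.2.2.1.le hHN
        (ih (hodd.of_dvd_nat N.card_quotient_dvd_card) (h.quotient hq ?_ hmem hN)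
          (hKH.map_mk hHN) ?_)
      · exact hodd.of_dvd_nat (orderOf_eq_prime hxq hx ▸ _root_.orderOf_dvd_natCard x)
      · have : N ≠ ⊥ := fun he ↦ hx (mem_bot.mp (he ▸ hxq))
        have := N.card_eq_card_quotient_mul_card_subgroup
        have := N.one_lt_card_iff_ne_bot.mpr ‹_›
        have := Nat.card_pos (α := G ⧸ N)
        nlinarith
    · push Not at hHN
      obtain ⟨z, hzH, hzN, hzK⟩ := hHN
      exact h.cyclicFactor hq hKH hzN hzH hzK

end PrimeOrderNormal

/-- Buckley: If `G` has odd order and every minimal subgroup of `G` is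
normal, then `G` is supersoluble (every chief factor is cyclic). -/
theorem stmt18 [Group G] [Finite G] (hodd : Odd (Nat.card G))
    (h : ∀ H : Subgroup G, (∃ q : ℕ, q.Prime ∧ Nat.card H = q) → H.Normal) :
    ∀ K H : Subgroup G, IsChiefFactor K H → CyclicFactor K H := by
  exact fun K H hKH ↦
    (primeOrderNormal_of_forall_subgroup h).cyclicFactor_of_isChiefFactor hodd hKH
end

section
/- (Huppert) Let P be a Sylow p-subgroup of a finite group G with |P| > p. Suppose G has a p-complement E (a subgroup with |E| = |G : P|) such that E permutes with every maximal subgroup of P (i.e., EM = ME for each maximal subgroup M of P). Then G is p-soluble. -/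
open Subgroup Pointwise

variable {G : Type*}

open scoped commutatorElement

/-- `PSeries p A` says that `A` is the last term of a descending series of normal subgroups
starting at the whole group, each of whose factors is a `p`-group, a `p'`-group or abelian. -/
inductive PSeries [Group G] (p : ℕ) : Subgroup G → Prop
  | top : PSeries p ⊤
  | step {A B : Subgroup G} : PSeries p A → B.Normal → B ≤ A →
      ((∃ n : ℕ, B.relIndex A = p ^ n) ∨ ¬ p ∣ B.relIndex A ∨ ⁅A, A⁆ ≤ B) → PSeries p B

lemma PSeries.normal [Group G] {p : ℕ} {A : Subgroup G} (h : PSeries p A) : A.Normal := by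
  cases h with
  | top => infer_instance
  | step _ hB _ _ => exact hB

lemma relIndex_dvd_of_normal_of_le [Group G] (N : Subgroup G) [N.Normal] {H K : Subgroup G}
    (h : H ≤ K) : N.relIndex H ∣ N.relIndex K := by
  rw [← relIndex_subgroupOf h]
  exact relIndex_dvd_index_of_normal _ _

lemma exists_eq_prime_pow_of_dvd {p m n : ℕ} (hp : p.Prime) (hm : ∃ k, m = p ^ k) (h : n ∣ m) :
    ∃ k, n = p ^ k := by
  obtain ⟨k, rfl⟩ := hm
  obtain ⟨l, -, hl⟩ := (Nat.dvd_prime_pow hp).1 h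
  exact ⟨l, hl⟩

lemma PSeries.inf [Group G] {p : ℕ} (hp : p.Prime) {A B : Subgroup G} (hA : PSeries p A)
    (hB : PSeries p B) : PSeries p (A ⊓ B) := by
  induction hB with
  | top => simpa using hA
  | @step C D hC hD hDC h ih =>
    have hAn := hA.normal
    have hdvd : (A ⊓ D).relIndex (A ⊓ C) ∣ D.relIndex C := by
      have : A ⊓ D = D ⊓ (A ⊓ C) := by
        rw [inf_left_comm, inf_eq_left.2 hDC]
      rw [this, inf_relIndex_right]
      exact relIndex_dvd_of_normal_of_le D inf_le_right
    refine ih.step inferInstance (inf_le_inf_left A hDC) ?_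
    rcases h with h | h | h
    · exact Or.inl (exists_eq_prime_pow_of_dvd hp h hdvd)
    · exact Or.inr (Or.inl fun h' => h (h'.trans hdvd))
    · refine Or.inr (Or.inr (le_inf ?_ ((commutator_mono inf_le_right inf_le_right).trans h)))
      exact (commutator_mono inf_le_left inf_le_left).trans (commutator_le_self A)

lemma PSeries.of_eq_sup [Group G] {p : ℕ} {A K L : Subgroup G} (hK : K.Normal)
    (h : PSeries p A) (hA : A = K ⊔ L) (hd : ¬ p ∣ K.relIndex L) : PSeries p K := by
  refine h.step hK (hA ▸ le_sup_left) (Or.inr (Or.inl ?_))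
  rwa [hA, sup_comm, relIndex_sup_right]

/-- An abelian chief factor is a `p`-group or a `p'`-group. -/
lemma IsChiefFactor.of_commutator_le [Group G] [Finite G] {p : ℕ} (hp : p.Prime)
    {K H : Subgroup G} (hc : IsChiefFactor K H) (h : ⁅H, H⁆ ≤ K) :
    (∃ n : ℕ, (K.subgroupOf H).index = p ^ n) ∨ ¬ p ∣ (K.subgroupOf H).index := by
  have : Fact p.Prime := ⟨hp⟩
  obtain ⟨hK, hH, hlt, hmax⟩ := hc
  have hcomm : ∀ a ∈ H, ∀ b ∈ H, Commute (a : G ⧸ K) (b : G ⧸ K) := by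
    intro a ha b hb
    rw [← commutatorElement_eq_one_iff_commute]
    exact (QuotientGroup.eq_one_iff (N := K) ⁅a, b⁆).2 (h (commutator_mem_commutator ha hb))
  let N : Subgroup G :=
    { carrier := {x | x ∈ H ∧ (x : G ⧸ K) ^ p = 1}
      one_mem' := ⟨H.one_mem, by simp⟩
      mul_mem' := fun {a b} ha hb => ⟨H.mul_mem ha.1 hb.1, by
        rw [QuotientGroup.mk_mul, (hcomm a ha.1 b hb.1).mul_pow, ha.2, hb.2, one_mul]⟩
      inv_mem' := fun {a} ha => ⟨H.inv_mem ha.1, by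
        rw [QuotientGroup.mk_inv, inv_pow, ha.2, inv_one]⟩ }
  have hN : N.Normal := ⟨fun x hx g => ⟨hH.conj_mem x hx.1 g, by
    rw [QuotientGroup.mk_mul, QuotientGroup.mk_mul, QuotientGroup.mk_inv, conj_pow, hx.2]
    simp⟩⟩
  have hKN : K ≤ N := fun x hx => ⟨hlt.le hx, by
    rw [(QuotientGroup.eq_one_iff (N := K) x).2 hx, one_pow]⟩
  have hNH : N ≤ H := fun x hx => hx.1
  rcases hKN.eq_or_lt with hE | hE
  · right
    intro hd
    rw [index_eq_card] at hd
    obtain ⟨y, hy⟩ := exists_prime_orderOf_dvd_card' p hd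
    obtain ⟨x, rfl⟩ := QuotientGroup.mk_surjective y
    have hx : (x : G) ∈ N := by
      refine ⟨x.2, ?_⟩
      have := pow_orderOf_eq_one (x : H ⧸ K.subgroupOf H)
      rw [hy, ← QuotientGroup.mk_pow, QuotientGroup.eq_one_iff, mem_subgroupOf] at this
      rw [← QuotientGroup.mk_pow, QuotientGroup.eq_one_iff]
      simpa using this
    rw [← hE] at hx
    rw [(QuotientGroup.eq_one_iff (N := K.subgroupOf H) x).2 (mem_subgroupOf.2 hx),
      orderOf_one] at hy
    exact hp.one_lt.ne hy
  · left
    have hNe := hmax N hN hE hNH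
    rw [index_eq_card]
    refine IsPGroup.iff_card.1 (isPGroup_iff_pow_pow_eq_one.2 fun y => ⟨1, ?_⟩)
    obtain ⟨x, rfl⟩ := QuotientGroup.mk_surjective y
    have hx : (x : G) ∈ N := by rw [hNe]; exact x.2
    have := hx.2
    rw [← QuotientGroup.mk_pow, QuotientGroup.eq_one_iff] at this
    rw [pow_one, ← QuotientGroup.mk_pow, QuotientGroup.eq_one_iff, mem_subgroupOf]
    simpa using this

/-- A chief factor `H/K` is a `p`-group or a `p'`-group, or it is covered by every term of a
`PSeries`. -/
lemma PSeries.chiefFactor [Group G] [Finite G] {p : ℕ} (hp : p.Prime) {A : Subgroup G}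
    (hA : PSeries p A) {K H : Subgroup G} (hc : IsChiefFactor K H) :
    ((∃ n : ℕ, (K.subgroupOf H).index = p ^ n) ∨ ¬ p ∣ (K.subgroupOf H).index) ∨
      H ≤ K ⊔ H ⊓ A := by
  induction hA with
  | top => right; simp
  | @step A B hA hB hBA h ih =>
    rcases ih with ih | ih
    · exact Or.inl ih
    have hAn := hA.normal
    obtain ⟨hK, hH, hlt, hmax⟩ := id hc
    have hHA : K ⊔ H ⊓ A = H := le_antisymm (sup_le hlt.le inf_le_left) ih
    have hn : (K ⊔ H ⊓ B).Normal := inferInstance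
    rcases (le_sup_left : K ≤ K ⊔ H ⊓ B).eq_or_lt with hE | hE
    · left
      have hHB : H ⊓ B ≤ K := by rw [hE]; exact le_sup_right
      have hdvd : K.relIndex H ∣ B.relIndex A := by
        conv_lhs => rw [← hHA, sup_comm, relIndex_sup_right]
        refine dvd_trans ?_ (relIndex_dvd_of_normal_of_le B (inf_le_right : H ⊓ A ≤ A))
        rw [← inf_relIndex_right B]
        refine relIndex_dvd_of_le_left _ (le_trans ?_ hHB)
        exact le_inf (inf_le_right.trans inf_le_left) inf_le_left
      rcases h with h | h | h
      · exact Or.inl (exists_eq_prime_pow_of_dvd hp h hdvd)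
      · exact Or.inr fun h' => h (h'.trans hdvd)
      · refine hc.of_commutator_le hp ?_
        have : ∀ x ∈ H, ∃ y ∈ H ⊓ A, (x : G ⧸ K) = y := by
          intro x hx
          rw [← hHA] at hx
          obtain ⟨k, hk, y, hy, rfl⟩ := mem_sup_of_normal_left.1 hx
          refine ⟨y, hy, ?_⟩
          rw [QuotientGroup.mk_mul, (QuotientGroup.eq_one_iff (N := K) k).2 hk, one_mul]
        rw [commutator_le]
        intro a ha b hb
        obtain ⟨a', ha', haa⟩ := this a ha
        obtain ⟨b', hb', hbb⟩ := this b hb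
        have h1 : ⁅a', b'⁆ ∈ K :=
          hHB ⟨commutator_le_self H (commutator_mem_commutator ha'.1 hb'.1),
            h (commutator_mem_commutator ha'.2 hb'.2)⟩
        rw [← QuotientGroup.eq_one_iff] at h1 ⊢
        have h2 := map_commutatorElement (QuotientGroup.mk' K) a b
        have h3 := map_commutatorElement (QuotientGroup.mk' K) a' b'
        simp only [QuotientGroup.mk'_apply] at h2 h3
        rw [h2, haa, hbb, ← h3, h1]
    · right
      exact (hmax _ hn hE (sup_le hlt.le inf_le_left)).ge

lemma PSeries.pSoluble [Group G] [Finite G] {p : ℕ} (hp : p.Prime)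
    (h : PSeries p (⊥ : Subgroup G)) : pSoluble p G := by
  intro K H hc
  refine (h.chiefFactor hp hc).resolve_right fun hle => ?_
  rw [inf_bot_eq, sup_bot_eq] at hle
  exact hc.2.2.1.not_ge hle

lemma not_dvd_relIndex_of_normal [Group G] [Finite G] {p : ℕ} {P : Subgroup G}
    (hP : ¬ p ∣ P.index) (L : Subgroup G) [L.Normal] : ¬ p ∣ P.relIndex L := by
  have hPL : P.relIndex L = P.relIndex (P ⊔ L) := by
    have e1 := relIndex_mul_relIndex (P ⊓ L : Subgroup G) L (P ⊔ L) inf_le_right le_sup_right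
    have e2 := relIndex_mul_relIndex (P ⊓ L : Subgroup G) P (P ⊔ L) inf_le_left le_sup_left
    rw [inf_relIndex_right, relIndex_sup_right] at e1
    rw [inf_relIndex_left, ← e1, mul_comm] at e2
    have : L.relIndex P ≠ 0 := fun h =>
      index_ne_zero_of_finite (index_eq_zero_of_relIndex_eq_zero h)
    exact (Nat.eq_of_mul_eq_mul_right (Nat.pos_of_ne_zero this) e2).symm
  rw [hPL]
  exact fun h => hP (h.trans (relIndex_dvd_index_of_le le_sup_left))

lemma not_dvd_relIndex_of_inf_le [Group G] [Finite G] {p : ℕ} {P : Subgroup G}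
    (hP : ¬ p ∣ P.index) {K L : Subgroup G} [L.Normal] (h : P ⊓ L ≤ K) :
    ¬ p ∣ K.relIndex L := by
  intro hd
  refine not_dvd_relIndex_of_normal hP L (hd.trans ?_)
  rw [← inf_relIndex_right P]
  exact relIndex_dvd_of_le_left L h

lemma not_le_commutator_top [Group G] [Group.IsNilpotent G] {Q : Subgroup G} (hQ : Q ≠ ⊥) :
    ¬ Q ≤ ⁅Q, (⊤ : Subgroup G)⁆ := by
  intro h
  obtain ⟨n, hn⟩ := Subgroup.nilpotent_iff_lowerCentralSeries.1 (inferInstance : Group.IsNilpotent G)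
  have : ∀ k, Q ≤ (⊤ : Subgroup G).lowerCentralSeries k := by
    intro k
    induction k with
    | zero => exact le_top
    | succ k ih => exact h.trans (commutator_mono ih le_rfl)
  refine hQ (le_bot_iff.1 ?_)
  rw [← hn]
  exact this n

/-- A special case of Tate's theorem: if a normal subgroup `T` generated by `p'`-elements meets a
Sylow `p`-subgroup inside its Frattini subgroup, then `T` is a `p'`-group. -/
lemma not_dvd_card_of_subgroupOf_le_frattini [Group G] [Finite G] {p : ℕ} [Fact p.Prime]
    {P : Subgroup G} (hPp : IsPGroup p P) (hP : ¬ p ∣ P.index) (T : Subgroup G) [T.Normal]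
    (hgen : T ≤ closure {g | g ∈ T ∧ ¬ p ∣ orderOf g})
    (hfr : T.subgroupOf P ≤ frattini P) : ¬ p ∣ Nat.card T := by
  intro hd
  set Q : Subgroup P := T.subgroupOf P
  have : Group.IsNilpotent P := hPp.isNilpotent
  have hQ : Q ≠ ⊥ := by
    intro hbot
    have : T.subgroupOf P = ⊥ := hbot
    rw [subgroupOf_eq_bot, disjoint_iff] at this
    apply not_dvd_relIndex_of_normal hP T
    rwa [← inf_relIndex_right, inf_comm, this, relIndex_bot_left]
  have hQR := not_le_commutator_top hQ
  set R : Subgroup P := ⁅Q, (⊤ : Subgroup P)⁆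
  have hRQ : R ≤ Q := commutator_le_left Q ⊤
  let A : Subgroup (P ⧸ R) := Q.map (QuotientGroup.mk' R)
  have hAc : ∀ a ∈ A, ∀ y : P ⧸ R, a * y = y * a := by
    rintro _ ⟨q, hq, rfl⟩ y
    obtain ⟨x, rfl⟩ := QuotientGroup.mk_surjective y
    rw [← commutatorElement_eq_one_iff_mul_comm]
    exact (QuotientGroup.eq_one_iff (N := R) ⁅q, x⁆).2 (commutator_mem_commutator hq (mem_top x))
  let _ : CommGroup A :=
    { (inferInstance : Group A) with mul_comm := fun a b => Subtype.ext (hAc a a.2 b) }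
  have hAp : IsPGroup p A := (hPp.to_quotient R).to_subgroup A
  let ρ : P ⧸ R →* G ⧸ T := QuotientGroup.lift R ((QuotientGroup.mk' T).comp P.subtype)
    fun x hx => (QuotientGroup.eq_one_iff (N := T) (x : G)).2 (mem_subgroupOf.1 (hRQ hx))
  let D : Subgroup (G × (P ⧸ R)) :=
    ((QuotientGroup.mk' T).comp (MonoidHom.fst G (P ⧸ R))).eqLocus
      (ρ.comp (MonoidHom.snd G (P ⧸ R)))
  let π : D →* G := (MonoidHom.fst G (P ⧸ R)).comp D.subtype
  let H : Subgroup D := P.comap π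
  have hψ : ∀ h : H, ((⟨(h : D).1.1, h.2⟩ : P) : P ⧸ R)⁻¹ * (h : D).1.2 ∈ A := by
    rintro ⟨⟨⟨g, y⟩, hD⟩, hg⟩
    obtain ⟨x, rfl⟩ := QuotientGroup.mk_surjective y
    have hD' : (g : G ⧸ T) = ((x : G) : G ⧸ T) := hD
    exact ⟨⟨g, hg⟩⁻¹ * x, mem_subgroupOf.2 (QuotientGroup.eq.1 hD'), rfl⟩
  let ψ : H →* A :=
    { toFun := fun h => ⟨_, hψ h⟩
      map_one' := by
        apply Subtype.ext
        change ((1 : P) : P ⧸ R)⁻¹ * 1 = 1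
        simp
      map_mul' := fun a b => by
        apply Subtype.ext
        change (((⟨(a : D).1.1, a.2⟩ * ⟨(b : D).1.1, b.2⟩ : P)) : P ⧸ R)⁻¹ *
          ((a : D).1.2 * (b : D).1.2) = _ * (a : D).1.2 * (_ * (b : D).1.2)
        have := hAc _ (hψ a) ((⟨(b : D).1.1, b.2⟩ : P) : P ⧸ R)⁻¹
        rw [QuotientGroup.mk_mul, mul_inv_rev, ← mul_assoc, mul_assoc _ _ (a : D).1.2, ← this,
          mul_assoc] }
  let τ : D →* A := MonoidHom.transfer ψ
  have hm : (Nat.card A).Coprime H.index := by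
    obtain ⟨n, hn⟩ := IsPGroup.iff_card.1 hAp
    rw [hn]
    refine Nat.Coprime.pow_left n ((Nat.Prime.coprime_iff_not_dvd Fact.out).2 fun hdvd => ?_)
    have hPr : P ≤ π.range := fun x hx =>
      ⟨⟨(x, ((⟨x, hx⟩ : P) : P ⧸ R)), rfl⟩, rfl⟩
    rw [index_comap] at hdvd
    exact hP (hdvd.trans (relIndex_dvd_index_of_le hPr))
  let σ : T →* D :=
    { toFun := fun t => ⟨(t, 1), (QuotientGroup.eq_one_iff (N := T) (t : G)).2 t.2⟩
      map_one' := rfl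
      map_mul' := fun a b => Subtype.ext (Prod.ext rfl (one_mul 1).symm) }
  have hσ : ∀ t, τ (σ t) = 1 := by
    have : T ≤ (τ.comp σ).ker.map T.subtype := by
      refine hgen.trans ((closure_le _).2 fun g hg => ⟨⟨g, hg.1⟩, ?_, rfl⟩)
      change (τ.comp σ) ⟨g, hg.1⟩ = 1
      by_contra hne
      refine hg.2 ((hAp.dvd_orderOf hne).trans ((orderOf_map_dvd _ _).trans ?_))
      rw [Subgroup.orderOf_mk]
    intro t
    obtain ⟨s, hs, hst⟩ := this t.2
    rw [← Subtype.ext hst]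
    exact hs
  let δ : P →* D :=
    { toFun := fun x => ⟨((x : G), (x : P ⧸ R)), rfl⟩
      map_one' := rfl
      map_mul' := fun a b => rfl }
  have hlam : ∀ (q : P) (hq : q ∈ Q), τ (δ q) = (⟨q, q, hq, rfl⟩ : A) ^ H.index := by
    intro q hq
    let z : D := ⟨(1, (q : P ⧸ R)), ((QuotientGroup.eq_one_iff (N := T) (q : G)).2 hq).symm⟩
    have hz : δ q = σ ⟨q, hq⟩ * z :=
      Subtype.ext (Prod.ext (mul_one (q : G)).symm (one_mul (q : P ⧸ R)).symm)
    have hzc : ∀ d : D, Commute z d := fun d =>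
      Subtype.ext (Prod.ext ((one_mul _).trans (mul_one _).symm) (hAc _ ⟨q, hq, rfl⟩ _))
    have hkey : ∀ (k : ℕ) (d : D), d⁻¹ * z ^ k * d ∈ H → d⁻¹ * z ^ k * d = z ^ k := by
      intro k d _
      rw [mul_assoc, ((hzc d).pow_left k).eq, inv_mul_cancel_left]
    rw [hz, map_mul, hσ, one_mul]
    refine (MonoidHom.transfer_eq_pow ψ z hkey).trans (Subtype.ext ?_)
    have h1 : ((z ^ H.index : D) : G × (P ⧸ R)) = (1, (q : P ⧸ R) ^ H.index) := by
      rw [SubgroupClass.coe_pow]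
      exact Prod.ext (one_pow _) rfl
    have h2 : ∀ (w : D) (hw : w ∈ H), (w : G × (P ⧸ R)) = (1, (q : P ⧸ R) ^ H.index) →
        ((ψ ⟨w, hw⟩ : A) : P ⧸ R) = (q : P ⧸ R) ^ H.index := by
      rintro ⟨w, hwD⟩ hw rfl
      change ((1 : P) : P ⧸ R)⁻¹ * _ = _
      simp
    exact h2 _ _ h1
  have hsup : (τ.comp δ).ker ⊔ frattini P = ⊤ := by
    refine eq_top_iff.2 fun x _ => ?_
    obtain ⟨⟨_, q, hq, rfl⟩, hb⟩ := (powCoprime hm).surjective (τ (δ x))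
    have hx : x * q⁻¹ ∈ (τ.comp δ).ker := by
      rw [MonoidHom.mem_ker, MonoidHom.comp_apply, map_mul, map_mul, map_inv, map_inv, hlam q hq,
        mul_inv_eq_one, ← hb]
      exact powCoprime_apply hm _
    have := mul_mem_sup hx (hfr hq)
    rwa [inv_mul_cancel_right] at this
  have htop := frattini_nongenerating hsup
  refine hQR fun q hq => ?_
  have h1 : τ (δ q) = 1 := by
    have : q ∈ (τ.comp δ).ker := by rw [htop]; exact mem_top q
    exact this
  rw [hlam q hq, ← powCoprime_apply hm, ← powCoprime_one hm] at h1
  have := (powCoprime hm).injective h1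
  exact (QuotientGroup.eq_one_iff (N := R) q).1 (congrArg Subtype.val this)

/-- A normal subgroup meeting a Sylow `p`-subgroup inside its Frattini subgroup has a `p'`-subgroup
of `p`-power index that is normal in the whole group. -/
lemma exists_normal_not_dvd_card_of_subgroupOf_le_frattini [Group G] [Finite G] {p : ℕ}
    [Fact p.Prime] {P : Subgroup G} (hPp : IsPGroup p P) (hP : ¬ p ∣ P.index)
    (N : Subgroup G) [hN : N.Normal]
    (hfr : N.subgroupOf P ≤ frattini P) :
    ∃ T : Subgroup G, T.Normal ∧ T ≤ N ∧ ¬ p ∣ Nat.card T ∧ ∃ n : ℕ, T.relIndex N = p ^ n := by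
  have hp : p.Prime := Fact.out
  let T : Subgroup G := closure {g | g ∈ N ∧ ¬ p ∣ orderOf g}
  have hTN : T ≤ N := (closure_le _).2 fun g hg => hg.1
  have hT : T.Normal := by
    refine Subgroup.Normal.mk fun x hx g => ?_
    have : T.map (MulAut.conj g).toMonoidHom ≤ T := by
      rw [MonoidHom.map_closure, closure_le]
      rintro _ ⟨y, hy, rfl⟩
      refine subset_closure ⟨hN.conj_mem y hy.1 g, fun h => hy.2 ?_⟩
      rwa [MulEquiv.toMonoidHom_eq_coe, MonoidHom.coe_coe, MulEquiv.orderOf_eq] at h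
    exact this ⟨x, hx, rfl⟩
  refine ⟨T, hT, hTN, not_dvd_card_of_subgroupOf_le_frattini hPp hP T ?_ ?_, ?_⟩
  · exact closure_mono fun g hg => ⟨subset_closure hg, hg.2⟩
  · exact (comap_mono hTN).trans hfr
  · change ∃ n : ℕ, (T.subgroupOf N).index = p ^ n
    rw [index_eq_card]
    refine IsPGroup.iff_card.1 (isPGroup_iff_pow_pow_eq_one.2 fun y => ?_)
    obtain ⟨x, rfl⟩ := QuotientGroup.mk_surjective y
    obtain ⟨k, m, hm, hk⟩ := Nat.exists_eq_pow_mul_and_not_dvd (orderOf_pos x).ne' p hp.ne_one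
    refine ⟨k, ?_⟩
    rw [← QuotientGroup.mk_pow, QuotientGroup.eq_one_iff, mem_subgroupOf]
    refine subset_closure ⟨(x ^ p ^ k).2, fun h => hm ?_⟩
    rwa [Subgroup.orderOf_coe, orderOf_pow_of_dvd (pow_pos hp.pos k).ne' (hk ▸ dvd_mul_right _ _),
      hk, Nat.mul_div_cancel_left _ (pow_pos hp.pos k)] at h

lemma IsPGroup.normal_of_isCoatom {X : Type*} [Group X] [Finite X] {p : ℕ} [Fact p.Prime]
    (hX : IsPGroup p X) {M : Subgroup X} (hM : IsCoatom M) : M.Normal := by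
  have := hX.isNilpotent
  exact NormalizerCondition.normal_of_coatom M Group.normalizerCondition_of_isNilpotent hM

lemma IsPGroup.index_of_isCoatom {X : Type*} [Group X] [Finite X] {p : ℕ} [Fact p.Prime]
    (hX : IsPGroup p X) {M : Subgroup X} (hM : IsCoatom M) : M.index = p := by
  obtain ⟨n, hn⟩ := IsPGroup.iff_card.1 (hX.to_subgroup M)
  have hlt : M.index ≠ 1 := fun h => hM.1 (index_eq_one.1 h)
  obtain ⟨k, hk⟩ := hX.index M
  have hk0 : k ≠ 0 := by
    rintro rfl
    exact hlt (by simpa using hk)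
  have hcard := M.card_mul_index
  have hdvd : p ^ (n + 1) ∣ Nat.card X := by
    rw [← hcard, hn, hk, pow_succ]
    exact mul_dvd_mul_left _ (dvd_pow_self p hk0)
  obtain ⟨K, hK, hMK⟩ := Sylow.exists_subgroup_card_pow_succ hdvd hn
  have hp : 1 < p := (Fact.out : p.Prime).one_lt
  have hKtop : K = ⊤ := by
    refine hM.2 K (lt_of_le_of_ne hMK ?_)
    rintro rfl
    rw [hn] at hK
    exact absurd (Nat.pow_right_injective hp hK) (by omega)
  rw [hKtop, card_top, ← hcard, hn, pow_succ] at hK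
  exact Nat.eq_of_mul_eq_mul_left (pow_pos (by omega) n) hK

lemma index_normalCore_dvd_factorial [Group G] [Finite G] (H : Subgroup G) :
    H.normalCore.index ∣ (H.index).factorial := by
  rw [normalCore_eq_ker, index_ker, index_eq_card, ← Nat.card_perm]
  exact card_subgroup_dvd_card _

lemma exists_subgroup_card_eq_of_permutes [Group G] [Finite G] {A B : Subgroup G}
    (h : permutes A B) (hAB : (Nat.card A).Coprime (Nat.card B)) :
    ∃ H : Subgroup G, B ≤ H ∧ Nat.card H = Nat.card A * Nat.card B := by
  let H : Subgroup G :=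
    { carrier := (A : Set G) * (B : Set G)
      one_mem' := ⟨1, A.one_mem, 1, B.one_mem, one_mul 1⟩
      mul_mem' := by
        rintro x y hx hy
        have : x * y ∈ ((A : Set G) * B) * ((A : Set G) * B) := ⟨x, hx, y, hy, rfl⟩
        rw [mul_assoc, ← mul_assoc (B : Set G), ← (show _ = _ from h), mul_assoc, coe_mul_coe,
          ← mul_assoc, coe_mul_coe] at this
        exact this
      inv_mem' := by
        rintro x hx
        have : x⁻¹ ∈ ((A : Set G) * B)⁻¹ := Set.inv_mem_inv.2 hx
        rw [mul_inv_rev, inv_coe_set, inv_coe_set, ← (show _ = _ from h)] at this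
        exact this }
  have hA : A ≤ H := fun a ha => ⟨a, ha, 1, B.one_mem, mul_one a⟩
  have hB : B ≤ H := fun b hb => ⟨1, A.one_mem, b, hb, one_mul b⟩
  refine ⟨H, hB, le_antisymm ?_ (Nat.le_of_dvd Nat.card_pos ?_)⟩
  · exact Set.natCard_mul_le
  · exact hAB.mul_dvd_of_dvd_of_dvd (card_dvd_of_le hA) (card_dvd_of_le hB)

lemma exists_normal_subgroupOf_eq [Group G] [Finite G] {p : ℕ} [Fact p.Prime]
    {P E : Subgroup G} (hPp : IsPGroup p P) (hEp : ¬ p ∣ Nat.card E)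
    (hEi : Nat.card E * Nat.card P = Nat.card G)
    (hperm : ∀ M : Subgroup G, M < P →
      (∀ L : Subgroup G, M < L → L ≤ P → L = P) → permutes E M)
    {M : Subgroup P} (hM : IsCoatom M) : ∃ K : Subgroup G, K.Normal ∧ K.subgroupOf P = M := by
  have hp : p.Prime := Fact.out
  have hlt : M.map P.subtype < P := by
    refine lt_of_le_of_ne (map_subtype_le M) fun h => hM.1 ?_
    rw [← subgroupOf_eq_top.2 h.ge, ← comap_subtype,
      comap_map_eq_self_of_injective P.subtype_injective]
  have hcard : Nat.card (M.map P.subtype) = Nat.card M :=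
    card_map_of_injective P.subtype_injective
  have hMi : M.index = p := hPp.index_of_isCoatom hM
  have hMc := M.card_mul_index
  have hper : permutes E (M.map P.subtype) := by
    refine hperm _ hlt fun L hL hLP => ?_
    have : L.subgroupOf P = ⊤ := by
      refine hM.2 _ (lt_of_le_of_ne (map_le_iff_le_comap.1 hL.le) ?_)
      rintro rfl
      refine hL.ne ?_
      rw [subgroupOf_map_subtype, inf_eq_left.2 hLP]
    exact le_antisymm hLP (subgroupOf_eq_top.1 this)
  obtain ⟨n, hn⟩ := IsPGroup.iff_card.1 (hPp.to_subgroup M)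
  obtain ⟨H, hMH, hHc⟩ := exists_subgroup_card_eq_of_permutes hper (by
    rw [hcard, hn]
    exact ((Nat.Prime.coprime_iff_not_dvd hp).2 hEp).symm.pow_right n)
  have hHi : H.index = p := by
    have h1 := H.card_mul_index
    rw [hHc, hcard, ← hEi, ← hMc, hMi, ← mul_assoc] at h1
    exact Nat.eq_of_mul_eq_mul_left (Nat.mul_pos Nat.card_pos Nat.card_pos) h1
  have hHM : H.subgroupOf P = M := by
    have hle : M ≤ H.subgroupOf P := map_le_iff_le_comap.1 hMH
    rcases hM.le_iff.1 hle with h | h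
    · have hPH : P ≤ H := subgroupOf_eq_top.1 h
      exfalso
      have h2 := card_dvd_of_le hPH
      rw [hHc, hcard, ← hMc, hMi, mul_comm] at h2
      exact hEp (Nat.dvd_of_mul_dvd_mul_right Nat.card_pos h2)
    · exact h
  have hKM : H.normalCore.subgroupOf P ≤ M := hHM ▸ comap_mono H.normalCore_le
  refine ⟨H.normalCore, inferInstance, le_antisymm hKM ?_⟩
  obtain ⟨k, hk⟩ : ∃ k, (H.normalCore.subgroupOf P).index = p ^ k := hPp.index _
  have hdvd : p ^ k ∣ p.factorial := by
    rw [← hk, ← hHi]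
    exact (relIndex_dvd_index_of_normal _ _).trans (index_normalCore_dvd_factorial H)
  have hk1 : k ≤ 1 := by
    by_contra! h
    have h2 := (pow_dvd_pow p h).trans hdvd
    rw [← Nat.mul_factorial_pred hp.pos.ne', pow_succ, pow_one] at h2
    have h3 := Nat.dvd_of_mul_dvd_mul_left hp.pos h2
    have := (hp.dvd_factorial).1 h3
    have := hp.pos
    omega
  have hmul := relIndex_mul_index hKM
  rw [hMi, hk] at hmul
  have : p ^ k ≤ p ^ 1 := Nat.pow_le_pow_right hp.pos hk1
  refine relIndex_eq_one.1 ?_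
  have h0 : (H.normalCore.subgroupOf P).relIndex M ≠ 0 := fun h => by
    rw [h, zero_mul] at hmul
    exact (pow_pos hp.pos k).ne hmul
  rw [pow_one, ← hmul] at this
  nlinarith [hp.pos, Nat.pos_of_ne_zero h0]

lemma exists_isCoatom_ne_inf_le {X : Type*} [Group X] [Finite X] {p : ℕ} [Fact p.Prime]
    (hX : IsPGroup p X) {M N : Subgroup X} (hM : IsCoatom M) (hN : IsCoatom N) (hMN : M ≠ N) :
    ∃ L : Subgroup X, IsCoatom L ∧ L ≠ M ∧ N ⊓ L ≤ M := by
  have key : ∀ M : Subgroup X, IsCoatom M → ∃ φ : X →* Multiplicative (ZMod p), φ.ker = M := by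
    intro M hM
    have := hX.normal_of_isCoatom hM
    have hi := hX.index_of_isCoatom hM
    rw [index_eq_card] at hi
    let e : X ⧸ M ≃* Multiplicative (ZMod p) := mulEquivOfPrimeCardEq (p := p) hi (by simp)
    refine ⟨e.toMonoidHom.comp (QuotientGroup.mk' M), ?_⟩
    ext x
    simp
  obtain ⟨φ, rfl⟩ := key M hM
  obtain ⟨ψ, rfl⟩ := key N hN
  have hinf : ψ.ker ⊓ (φ * ψ).ker ≤ φ.ker := by
    rintro x ⟨h1, h2⟩
    replace h1 : _ = _ := h1
    replace h2 : _ = _ := h2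
    rw [MonoidHom.mem_ker]
    rwa [MonoidHom.mul_apply, h1, mul_one] at h2
  have hinf' : φ.ker ⊓ (φ * ψ).ker ≤ ψ.ker := by
    rintro x ⟨h1, h2⟩
    replace h1 : _ = _ := h1
    replace h2 : _ = _ := h2
    rw [MonoidHom.mem_ker]
    rwa [MonoidHom.mul_apply, h1, one_mul] at h2
  have hne : (φ * ψ).ker ≠ ⊤ := by
    intro h
    rw [h, inf_top_eq] at hinf hinf'
    exact hMN (le_antisymm hinf' hinf)
  have hp : p.Prime := Fact.out
  have hind : ∀ K : Subgroup X, K ≠ ⊤ → K.index ∣ p → IsCoatom K := by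
    intro K hK hKp
    refine ⟨hK, fun L hL => ?_⟩
    have hKp' : K.index = p := (hp.eq_one_or_self_of_dvd _ hKp).resolve_left
      fun h => hK (index_eq_one.1 h)
    have h := relIndex_mul_index hL.le
    have h1 : K.relIndex L ≠ 1 := fun h => hL.not_ge (relIndex_eq_one.1 h)
    rw [hKp'] at h
    have h2 := (Nat.prime_mul_iff.1 (h.symm ▸ hp))
    rcases h2 with h2 | h2
    · exact index_eq_one.1 h2.2
    · exact absurd h2.2 h1
  refine ⟨(φ * ψ).ker, hind _ hne ?_, ?_, hinf⟩
  · rw [index_ker]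
    simpa using card_subgroup_dvd_card (φ * ψ).range
  · intro h
    rw [h, inf_idem] at hinf'
    rcases hM.le_iff.1 hinf' with h' | h'
    · exact hN.1 h'
    · exact hMN h'.symm

lemma commutator_sup_le_sup_inf [Group G] {K L M : Subgroup G} [K.Normal] [L.Normal] [M.Normal] :
    ⁅K ⊔ L, K ⊔ M⁆ ≤ K ⊔ L ⊓ M := by
  have h : ⁅K ⊔ L, K ⊔ M⁆.map (QuotientGroup.mk' K) ≤ (L ⊓ M).map (QuotientGroup.mk' K) := by
    rw [map_commutator, Subgroup.map_sup, Subgroup.map_sup, QuotientGroup.map_mk'_self,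
      bot_sup_eq, bot_sup_eq, ← map_commutator]
    exact map_mono (le_inf (commutator_le_left L M) (commutator_le_right L M))
  rwa [map_le_iff_le_comap, QuotientGroup.comap_map_mk'] at h

/-- A three-subgroups argument modulo a Sylow `p`-subgroup. -/
lemma PSeries.of_inf_le [Group G] [Finite G] {p : ℕ} {P K L M : Subgroup G}
    (hP : ¬ p ∣ P.index) [hK : K.Normal] [L.Normal] [M.Normal] (hKL : P ≤ K ⊔ L) (hKM : P ≤ K ⊔ M)
    (h : P ⊓ (L ⊓ M) ≤ K) : PSeries p K := by
  have h1 : PSeries p ((K ⊔ L) ⊓ (K ⊔ M)) := by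
    refine PSeries.top.step inferInstance le_top (Or.inr (Or.inl fun hd => hP (hd.trans ?_)))
    rw [relIndex_top_right]
    exact index_dvd_of_le (le_inf hKL hKM)
  have h2 : PSeries p (K ⊔ L ⊓ M) := by
    refine h1.step inferInstance ?_ (Or.inr (Or.inr ?_))
    · exact le_inf (sup_le_sup_left inf_le_left K) (sup_le_sup_left inf_le_right K)
    · exact (commutator_mono inf_le_left inf_le_right).trans commutator_sup_le_sup_inf
  exact h2.of_eq_sup hK rfl (not_dvd_relIndex_of_inf_le hP h)

lemma le_sup_of_subgroupOf_isCoatom [Group G] {P K L : Subgroup G} [K.Normal] [L.Normal]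
    (hK : IsCoatom (K.subgroupOf P)) (hL : IsCoatom (L.subgroupOf P))
    (h : K.subgroupOf P ≠ L.subgroupOf P) : P ≤ K ⊔ L := by
  rw [← subgroupOf_eq_top]
  have h1 : K.subgroupOf P ≤ (K ⊔ L).subgroupOf P := comap_mono le_sup_left
  have h2 : L.subgroupOf P ≤ (K ⊔ L).subgroupOf P := comap_mono le_sup_right
  rcases hK.le_iff.1 h1 with h3 | h3
  · exact h3
  rcases hL.le_iff.1 h2 with h4 | h4
  · exact h4
  exact absurd (h3.symm.trans h4) h

lemma PSeries.exists_subgroupOf_le_frattini [Group G] [Finite G] {p : ℕ} [Fact p.Prime]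
    {P : Subgroup G} (h : ∀ M : Subgroup P, IsCoatom M → ∃ K, PSeries p K ∧ K.subgroupOf P = M) :
    ∃ K : Subgroup G, PSeries p K ∧ K.subgroupOf P ≤ frattini P := by
  have key : ∀ S : Set (Subgroup P), (∀ M ∈ S, IsCoatom M) →
      ∃ K : Subgroup G, PSeries p K ∧ K.subgroupOf P ≤ sInf S := by
    intro S
    induction S, S.toFinite using Set.Finite.induction_on with
    | empty => exact fun _ => ⟨⊤, PSeries.top, by simp⟩
    | @insert M S _ _ ih =>
      intro hS
      obtain ⟨K, hK, hKS⟩ := ih fun N hN => hS N (Set.mem_insert_of_mem M hN)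
      obtain ⟨L, hL, hLM⟩ := h M (hS M (Set.mem_insert M S))
      refine ⟨L ⊓ K, hL.inf Fact.out hK, ?_⟩
      rw [sInf_insert]
      exact le_inf ((comap_mono inf_le_left).trans hLM.le) ((comap_mono inf_le_right).trans hKS)
  obtain ⟨K, hK, hle⟩ := key {M | IsCoatom M} fun M hM => hM
  refine ⟨K, hK, hle.trans_eq ?_⟩
  rw [frattini, Order.radical, sInf_eq_iInf]

lemma PSeries.bot_of_not_dvd_card [Group G] {p : ℕ} {T : Subgroup G} (hT : PSeries p T)
    (h : ¬ p ∣ Nat.card T) : PSeries p (⊥ : Subgroup G) :=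
  hT.step inferInstance bot_le (Or.inr (Or.inl (by rwa [relIndex_bot_left])))

lemma PSeries.bot_of_isCoatom_ne [Group G] [Finite G] {p : ℕ} [Fact p.Prime] {P : Subgroup G}
    (hPp : IsPGroup p P) (hP : ¬ p ∣ P.index)
    (h : ∀ M : Subgroup P, IsCoatom M → ∃ K : Subgroup G, K.Normal ∧ K.subgroupOf P = M)
    {M N : Subgroup P} (hM : IsCoatom M) (hN : IsCoatom N) (hMN : M ≠ N) :
    PSeries p (⊥ : Subgroup G) := by
  have key : ∀ M : Subgroup P, IsCoatom M → ∃ K, PSeries p K ∧ K.subgroupOf P = M := by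
    intro A hA
    obtain ⟨B, hB, hAB⟩ : ∃ B : Subgroup P, IsCoatom B ∧ A ≠ B := by
      by_cases hAM : A = M
      · exact ⟨N, hN, hAM ▸ hMN⟩
      · exact ⟨M, hM, hAM⟩
    obtain ⟨C, hC, hCA, hle⟩ := exists_isCoatom_ne_inf_le hPp hA hB hAB
    obtain ⟨K, hK, rfl⟩ := h A hA
    obtain ⟨L, hL, rfl⟩ := h B hB
    obtain ⟨J, hJ, rfl⟩ := h C hC
    refine ⟨K, PSeries.of_inf_le hP (le_sup_of_subgroupOf_isCoatom hA hB hAB)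
      (le_sup_of_subgroupOf_isCoatom hA hC hCA.symm) fun x hx => ?_, rfl⟩
    exact mem_subgroupOf.1 (@hle ⟨x, hx.1⟩ ⟨hx.2.1, hx.2.2⟩)
  obtain ⟨K, hK, hfr⟩ := PSeries.exists_subgroupOf_le_frattini key
  have hKn := hK.normal
  obtain ⟨T, hT, hTK, hTp, hn⟩ :=
    exists_normal_not_dvd_card_of_subgroupOf_le_frattini hPp hP K hfr
  exact (hK.step hT hTK (Or.inl hn)).bot_of_not_dvd_card hTp

/-- A nontrivial element of an abelian Sylow `p`-subgroup which is central modulo a normal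
`p'`-subgroup is not in the derived subgroup. -/
lemma not_mem_commutator_of_commutatorElement_mem [Group G] [Finite G] {p : ℕ} [Fact p.Prime]
    {P : Subgroup G} [hPc : IsMulCommutative P] (hPp : IsPGroup p P) (hP : ¬ p ∣ P.index)
    {T : Subgroup G} [T.Normal] (hT : ¬ p ∣ Nat.card T) {z : G} (hzP : z ∈ P) (hz : z ≠ 1)
    (hzc : ∀ g : G, ⁅z, g⁆ ∈ T) : z ∉ commutator G := by
  have hp : p.Prime := Fact.out
  obtain ⟨n, hn⟩ := IsPGroup.iff_card.1 hPp
  have hPT : P ⊓ T = ⊥ := (disjoint_of_coprime_natCard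
    (by rw [hn]; exact ((Nat.Prime.coprime_iff_not_dvd hp).2 hT).pow_left n)).eq_bot
  let _ : CommGroup P := { (inferInstance : Group P) with mul_comm := mul_comm' }
  let τ : G →* P := MonoidHom.transfer (MonoidHom.id P)
  have hkey : ∀ (k : ℕ) (g : G), g⁻¹ * z ^ k * g ∈ P → g⁻¹ * z ^ k * g = z ^ k := by
    intro k g hg
    have h1 : Commute (z : G ⧸ T) (g : G ⧸ T) := by
      rw [← commutatorElement_eq_one_iff_commute]
      exact (QuotientGroup.eq_one_iff (N := T) ⁅z, g⁆).2 (hzc g)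
    have h2 : z ^ k * (g⁻¹ * z ^ k * g)⁻¹ ∈ T := by
      rw [← QuotientGroup.eq_one_iff]
      simp only [QuotientGroup.mk_mul, QuotientGroup.mk_inv, QuotientGroup.mk_pow]
      rw [mul_assoc _ _ (g : G ⧸ T), (h1.pow_left k).eq, inv_mul_cancel_left, mul_inv_cancel]
    have h3 : z ^ k * (g⁻¹ * z ^ k * g)⁻¹ ∈ P ⊓ T :=
      ⟨P.mul_mem (P.pow_mem hzP k) (P.inv_mem hg), h2⟩
    rw [hPT, mem_bot, mul_inv_eq_one] at h3
    exact h3.symm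
  intro hzG
  have h1 : τ z = 1 := Abelianization.commutator_subset_ker τ hzG
  have h2 : z ^ P.index = 1 :=
    congrArg Subtype.val ((MonoidHom.transfer_eq_pow (MonoidHom.id P) z hkey).symm.trans h1)
  have h3 := hPp.dvd_orderOf (g := ⟨z, hzP⟩) fun h => hz (congrArg Subtype.val h)
  rw [Subgroup.orderOf_mk] at h3
  exact hP (h3.trans (orderOf_dvd_of_pow_eq_one h2))

lemma isCyclic_of_unique_isCoatom {X : Type*} [Group X] [Finite X] {M : Subgroup X}
    (hM : IsCoatom M) (h : ∀ N : Subgroup X, IsCoatom N → N = M) : IsCyclic X := by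
  obtain ⟨x, -, hx⟩ := SetLike.exists_of_lt hM.lt_top
  refine ⟨x, fun y => ?_⟩
  rcases eq_top_or_exists_le_coatom (zpowers x) with ht | ⟨N, hN, hle⟩
  · exact mem_zpowers_iff.1 (ht ▸ mem_top y)
  · exact absurd (hle (mem_zpowers x)) (h N hN ▸ hx)

lemma PSeries.bot_of_unique_isCoatom [Group G] [Finite G] {p : ℕ} [Fact p.Prime] {P : Subgroup G}
    (hPp : IsPGroup p P) (hP : ¬ p ∣ P.index) (hPcard : p < Nat.card P)
    {K : Subgroup G} [hK : K.Normal] (hKc : IsCoatom (K.subgroupOf P))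
    (h : ∀ N : Subgroup P, IsCoatom N → N = K.subgroupOf P) :
    PSeries p (⊥ : Subgroup G) := by
  have hp : p.Prime := Fact.out
  have hcyc := isCyclic_of_unique_isCoatom hKc h
  have hfr : K.subgroupOf P ≤ frattini P := le_iInf₂ fun N hN => (h N hN).ge
  obtain ⟨T, hT, hTK, hTp, n, hn⟩ :=
    exists_normal_not_dvd_card_of_subgroupOf_le_frattini hPp hP K hfr
  let C : Subgroup G := (centralizer (K.map (QuotientGroup.mk' T) : Set (G ⧸ T))).comap
    (QuotientGroup.mk' T)
  have hKmap : (K.map (QuotientGroup.mk' T)).Normal := hK.map _ (QuotientGroup.mk'_surjective T)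
  have hC : C.Normal := inferInstance
  have hKC : ∀ k ∈ K, ∀ c ∈ C, ⁅k, c⁆ ∈ T := by
    intro k hk c hc
    rw [← QuotientGroup.eq_one_iff]
    exact commutatorElement_eq_one_iff_mul_comm.2 (mem_centralizer_iff.1 hc _ ⟨k, hk, rfl⟩)
  have hKT : K = T ⊔ P ⊓ K := by
    refine le_antisymm ?_ (sup_le hTK inf_le_right)
    have h1 : ¬ p ∣ (T ⊔ P ⊓ K).relIndex K :=
      not_dvd_relIndex_of_inf_le hP le_sup_right
    obtain ⟨k, hk⟩ := exists_eq_prime_pow_of_dvd hp ⟨n, hn⟩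
      (relIndex_dvd_of_le_left K (le_sup_left : T ≤ T ⊔ P ⊓ K))
    rcases k.eq_zero_or_pos with rfl | hk0
    · exact relIndex_eq_one.1 (by rw [hk, pow_zero])
    · exact absurd (hk ▸ dvd_pow_self p hk0.ne') h1
  have hPC : P ≤ C := by
    intro x hx
    refine mem_centralizer_iff.2 ?_
    rintro _ ⟨k, hk, rfl⟩
    rw [SetLike.mem_coe, hKT] at hk
    obtain ⟨t, ht, y, hy, rfl⟩ := mem_sup_of_normal_left.1 hk
    rw [map_mul, show QuotientGroup.mk' T t = 1 from (QuotientGroup.eq_one_iff (N := T) t).2 ht,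
      one_mul, ← map_mul, ← map_mul]
    exact congrArg _ (congrArg Subtype.val (mul_comm' (⟨y, hy.1⟩ : P) ⟨x, hx⟩))
  have hCs : PSeries p C := by
    refine PSeries.top.step hC le_top (Or.inr (Or.inl fun hd => hP (hd.trans ?_)))
    rw [relIndex_top_right]
    exact index_dvd_of_le hPC
  refine (hCs.step inferInstance (commutator_le_self C) (Or.inr (Or.inr le_rfl))).bot_of_not_dvd_card
    fun hd => ?_
  have hDp : p ∣ Nat.card (P ⊓ ⁅C, C⁆ : Subgroup G) := by
    refine (hPp.to_le inf_le_left).card_eq_or_dvd.resolve_left fun h1 => ?_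
    refine not_dvd_relIndex_of_inf_le hP (card_eq_one.1 h1).le ?_
    rwa [relIndex_bot_left]
  obtain ⟨⟨z, hzD⟩, hz⟩ := exists_prime_orderOf_dvd_card' p hDp
  rw [Subgroup.orderOf_mk] at hz
  obtain ⟨hzP, hzC⟩ := mem_inf.1 hzD
  have hzK : z ∈ K := by
    rcases eq_top_or_exists_le_coatom (zpowers (⟨z, hzP⟩ : P)) with ht | ⟨N, hN, hle⟩
    · have := Nat.card_zpowers (⟨z, hzP⟩ : P)
      rw [ht, card_top, Subgroup.orderOf_mk, hz] at this
      exact absurd this hPcard.ne'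
    · exact mem_subgroupOf.1 (h N hN ▸ hle (mem_zpowers _))
  refine not_mem_commutator_of_commutatorElement_mem (P := P.subgroupOf C) (T := T.subgroupOf C)
    (p := p) (z := ⟨z, hPC hzP⟩) (hPp.of_equiv (subgroupOfEquivOfLe hPC).symm) ?_ ?_ hzP ?_ ?_ ?_
  · exact fun hd => hP (hd.trans (relIndex_dvd_index_of_le hPC))
  · exact fun hd => hTp (hd.trans (card_comap_dvd_of_injective T C.subtype C.subtype_injective))
  · intro h1
    rw [show z = 1 from congrArg Subtype.val h1, orderOf_one] at hz
    exact hp.one_lt.ne hz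
  · exact fun c => hKC z hzK c c.2
  · rw [← map_subtype_commutator] at hzC
    obtain ⟨w, hw, hwz⟩ := hzC
    rwa [show (⟨z, hPC hzP⟩ : C) = w from Subtype.ext hwz.symm]

/-- Huppert: If `|P| > p` for a Sylow `p`-subgroup `P` of `G`, and `G`
has a `p`-complement `E` permuting with every maximal subgroup of `P`, then `G` is
`p`-soluble. -/
theorem stmt19 [Group G] [Finite G] (p : ℕ) (hp : p.Prime) (P : Sylow p G)
    (hP : p < Nat.card (P : Subgroup G))
    (E : Subgroup G) (hEp : ¬ p ∣ Nat.card E)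
    (hEi : Nat.card E * Nat.card (P : Subgroup G) = Nat.card G)
    (hperm : ∀ M : Subgroup G, M < P →
      (∀ L : Subgroup G, M < L → L ≤ P → L = P) → permutes E M) :
    pSoluble p G := by
  have : Fact p.Prime := ⟨hp⟩
  have hPi : ¬ p ∣ (P : Subgroup G).index := P.not_dvd_index
  have hnormal : ∀ M : Subgroup (P : Subgroup G), IsCoatom M →
      ∃ K : Subgroup G, K.Normal ∧ K.subgroupOf P = M :=
    fun M hM => exists_normal_subgroupOf_eq P.2 hEp hEi hperm hM
  refine PSeries.pSoluble hp ?_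
  obtain ⟨M, hM⟩ : ∃ M : Subgroup (P : Subgroup G), IsCoatom M := by
    rcases eq_top_or_exists_le_coatom (⊥ : Subgroup (P : Subgroup G)) with h | ⟨M, hM, -⟩
    · have h1 := card_bot (G := (P : Subgroup G))
      rw [h, card_top] at h1
      exact absurd (h1 ▸ hP) hp.one_lt.not_gt
    · exact ⟨M, hM⟩
  by_cases h : ∀ N : Subgroup (P : Subgroup G), IsCoatom N → N = M
  · obtain ⟨K, hK, rfl⟩ := hnormal M hM
    exact PSeries.bot_of_unique_isCoatom P.2 hPi hP hM h
  · push Not at h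
    obtain ⟨N, hN, hNM⟩ := h
    exact PSeries.bot_of_isCoatom_ne P.2 hPi hnormal hN hM hNM
end
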